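/- Let μ be a positive, translation bounded, strongly almost periodic Radon measure on ℝ^d, and let c : ℝ^d → ℂ be its Fourier–Bohr coefficients, i.e., for every χ ∈ ℝ^d the limit lim_{R→∞} vol(B_R)⁻¹ ∫_{B_R} e^{−2πi⟨χ,t⟩} dμ(t) exists and equals c(χ). Assume that c is locally absolutely summable: for every compact K ⊆ ℝ^d, ∑_{x ∈ K} ‖c(x)‖ < ∞. Then μ is the Fourier transform of the pure point measure ν = ∑_x c(x) δ_{−x}; explicitly, for every continuous compactly supported f : ℝ^d → ℂ, the function ‖𝓕⁻¹f‖² is μ-integrable, the family (c(x)·(f*f̃)(−x))_{x ∈ ℝ^d} is summable, and ∑_{x ∈ ℝ^d} c(x)·(f*f̃)(−x) = ∫_{ℝ^d} ‖𝓕⁻¹f(ξ)‖² dμ(ξ). -/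

import Mathlib

open MeasureTheory Metric Filter
open scoped Pointwise FourierTransform RealInnerProductSpace ENNReal Topology

noncomputable section

/-- A bounded continuous function is Bohr (strongly) almost periodic if its set of translates is
totally bounded in the supremum norm (expressed via finite `ε`-nets of translates). -/
def IsBohrAlmostPeriodic {d : ℕ} (F : EuclideanSpace ℝ (Fin d) → ℂ) : Prop :=
  Continuous F ∧ (∃ C : ℝ, ∀ t, ‖F t‖ ≤ C) ∧
    ∀ ε : ℝ, 0 < ε → ∃ S : Finset (EuclideanSpace ℝ (Fin d)),
      ∀ s : EuclideanSpace ℝ (Fin d), ∃ s₀ ∈ S,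
        ∀ t : EuclideanSpace ℝ (Fin d), ‖F (t - s) - F (t - s₀)‖ ≤ ε

/-- `c χ` is the Fourier–Bohr coefficient of `μ` at `χ`. -/
def IsFourierBohrCoeff {d : ℕ} (μ : Measure (EuclideanSpace ℝ (Fin d)))
    (χ : EuclideanSpace ℝ (Fin d)) (a : ℂ) : Prop :=
  Tendsto (fun R : ℝ =>
      ((volume (ball (0 : EuclideanSpace ℝ (Fin d)) R)).toReal)⁻¹ •
        ∫ t in ball (0 : EuclideanSpace ℝ (Fin d)) R,
          Complex.exp (((-(2 * Real.pi * ⟪χ, t⟫)) : ℝ) * Complex.I) ∂μ)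
    atTop (𝓝 a)

abbrev VV (d : ℕ) := EuclideanSpace ℝ (Fin d)

/-- the character `t ↦ exp(2πi⟨χ,t⟩)` -/
def ec {d : ℕ} (χ t : VV d) : ℂ := Complex.exp (((2 * Real.pi * ⟪χ, t⟫ : ℝ)) * Complex.I)

/-- volume of balls -/
def bv (d : ℕ) (R : ℝ) : ℝ := (volume (ball (0 : VV d) R)).toReal

/-- mean over the ball of radius `R` around `x` -/
def Mn {d : ℕ} (R : ℝ) (x : VV d) (u : VV d → ℂ) : ℂ :=
  (bv d R)⁻¹ • ∫ t in ball (0 : VV d) R, u (x + t)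

def APer {d : ℕ} (F : VV d → ℂ) : Prop :=
  ∀ ε : ℝ, 0 < ε → ∃ L : ℝ, 0 < L ∧ ∀ x : VV d, ∃ s : VV d, ‖s - x‖ ≤ L ∧
    ∀ t, ‖F (t + s) - F t‖ ≤ ε

def bet (d : ℕ) (R y : ℝ) : ℝ := ((R + y) / R) ^ d - 1

section basics
variable {d : ℕ}

lemma ec_add (χ s t : VV d) : ec χ (s + t) = ec χ s * ec χ t := by
  simp only [ec, ← Complex.exp_add, inner_add_right]
  congr 1; push_cast; ring

lemma ec_add_left (χ ψ t : VV d) : ec (χ + ψ) t = ec χ t * ec ψ t := by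
  simp only [ec, ← Complex.exp_add, inner_add_left]
  congr 1; push_cast; ring

lemma ec_neg_left (χ t : VV d) : ec (-χ) t = ec χ (-t) := by
  simp [ec]

lemma ec_zero (χ : VV d) : ec χ 0 = 1 := by simp [ec]

lemma norm_ec (χ t : VV d) : ‖ec χ t‖ = 1 := by
  rw [ec, Complex.norm_exp_ofReal_mul_I]

lemma ec_neg_mul (χ t : VV d) : ec (-χ) t * ec χ t = 1 := by
  rw [ec_neg_left, ← ec_add]; simp [ec_zero]

lemma conj_ec (χ t : VV d) : (starRingEnd ℂ) (ec χ t) = ec (-χ) t := by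
  simp [ec, ← Complex.exp_conj, Complex.conj_ofNat]

@[fun_prop]
lemma continuous_ec (χ : VV d) : Continuous (ec χ) := by
  unfold ec; fun_prop

@[fun_prop]
lemma continuous_ec_left (t : VV d) : Continuous (fun χ => ec χ t) := by
  unfold ec; fun_prop

lemma ec_sub_one_le (χ t : VV d) : ‖ec χ t - 1‖ ≤ 2 * Real.pi * ‖χ‖ * ‖t‖ := by
  have h := Real.norm_exp_I_mul_ofReal_sub_one_le (x := 2 * Real.pi * ⟪χ, t⟫)
  rw [mul_comm] at h
  refine h.trans ?_
  rw [Real.norm_eq_abs, abs_mul, abs_of_pos (by positivity : (0:ℝ) < 2 * Real.pi), mul_assoc _ ‖χ‖]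
  gcongr
  exact abs_real_inner_le_norm χ t

lemma ec_sub_le (χ ψ t : VV d) : ‖ec χ t - ec ψ t‖ ≤ 2 * Real.pi * ‖χ - ψ‖ * ‖t‖ := by
  have : ec χ t - ec ψ t = ec ψ t * (ec (χ - ψ) t - 1) := by
    rw [mul_sub, ← ec_add_left]; simp
  rw [this, norm_mul, norm_ec, one_mul]
  exact ec_sub_one_le _ _

lemma fourierInv_eq_ec (f : VV d → ℂ) (w : VV d) : 𝓕⁻ f w = ∫ v, f v * ec w v := by
  rw [Real.fourierInv_eq']
  refine integral_congr_ae (Eventually.of_forall fun v => ?_)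
  simp only [ec, smul_eq_mul]
  rw [mul_comm, real_inner_comm]

lemma fourier_eq_ec (f : VV d → ℂ) (w : VV d) : 𝓕 f w = ∫ v, f v * ec (-w) v := by
  rw [Real.fourier_eq']
  refine integral_congr_ae (Eventually.of_forall fun v => ?_)
  simp only [ec, smul_eq_mul]
  rw [mul_comm, real_inner_comm]; simp

lemma bv_eq {R : ℝ} (hR : 0 < R) : bv d R = R ^ d * bv d 1 := by
  unfold bv
  rw [Measure.addHaar_ball_of_pos _ _ hR]
  simp [hR.le]

lemma bv_pos {R : ℝ} (hR : 0 < R) : 0 < bv d R := by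
  unfold bv
  exact ENNReal.toReal_pos (measure_ball_pos _ _ hR).ne' measure_ball_lt_top.ne

lemma bet_tendsto (y : ℝ) : Tendsto (fun R => bet d R y) atTop (𝓝 0) := by
  have h1 : Tendsto (fun R : ℝ => (1 + y / R) ^ d - 1) atTop (𝓝 ((1 + 0) ^ d - 1)) := by
    apply Tendsto.sub_const
    apply Tendsto.pow
    apply Tendsto.const_add
    exact tendsto_const_nhds.div_atTop tendsto_id
  simp only [add_zero, one_pow, sub_self] at h1
  refine h1.congr' ?_
  filter_upwards [eventually_gt_atTop 0] with R hR
  simp only [bet]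
  rw [add_div, div_self hR.ne']

lemma bet_mono {R y z : ℝ} (hR : 0 < R) (hy : 0 ≤ y) (hyz : y ≤ z) : bet d R y ≤ bet d R z := by
  unfold bet; gcongr

lemma bet_nonneg {R y : ℝ} (hR : 0 < R) (hy : 0 ≤ y) : 0 ≤ bet d R y := by
  have := bet_mono (d := d) hR le_rfl hy
  refine le_trans ?_ this
  simp [bet, div_self hR.ne']

lemma integrableOn_of_bdd {u : VV d → ℂ} (hu : Continuous u) {s : Set (VV d)}
    {C : ℝ} (hC : ∀ t, ‖u t‖ ≤ C) (hs' : volume s < ⊤) : IntegrableOn u s := by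
  exact Measure.integrableOn_of_bounded (M := C) hs'.ne hu.aestronglyMeasurable
    (Eventually.of_forall hC)

lemma sub_ball_le {u : VV d → ℂ} (hu : Continuous u) {C : ℝ} (hC : ∀ t, ‖u t‖ ≤ C)
    {A B : Set (VV d)} (hA : MeasurableSet A) (hAB : A ⊆ B)
    (hB' : volume B < ⊤) :
    ‖(∫ t in B, u t) - ∫ t in A, u t‖ ≤ C * ((volume B).toReal - (volume A).toReal) := by
  rw [← setIntegral_sdiff hA (integrableOn_of_bdd hu hC hB') hAB]
  have h2 := norm_setIntegral_le_of_norm_le_const (μ := volume) (s := B \ A) (f := u) (C := C)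
    ((measure_mono Set.sdiff_subset).trans_lt hB') (fun t _ => hC t)
  refine h2.trans (le_of_eq ?_)
  rw [measureReal_sdiff hAB hA hB'.ne]
  rfl

lemma setIntegral_ball_shift (u : VV d → ℂ) (R : ℝ) (y : VV d) :
    ∫ t in ball (0 : VV d) R, u (y + t) = ∫ t in ball y R, u t := by
  have h := (measurePreserving_add_left (volume : Measure (VV d)) y).setIntegral_preimage_emb
    (measurableEmbedding_addLeft y) u (ball y R)
  rw [← h]
  congr 2
  ext t
  simp [mem_ball, dist_eq_norm]

lemma Mn_bdry {u : VV d → ℂ} (hu : Continuous u) {C : ℝ} (hC : ∀ t, ‖u t‖ ≤ C)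
    {R : ℝ} (hR : 0 < R) (y : VV d) :
    ‖Mn R y u - Mn R 0 u‖ ≤ 2 * C * bet d R ‖y‖ := by
  have hv := bv_pos (d := d) hR
  have hRy : 0 < R + ‖y‖ := by positivity
  unfold Mn
  rw [setIntegral_ball_shift, setIntegral_ball_shift, ← smul_sub, norm_smul]
  have h1 := sub_ball_le hu hC (A := ball y R) (B := ball 0 (R + ‖y‖)) measurableSet_ball
    (ball_subset_ball' (by simp)) measure_ball_lt_top
  have h2 := sub_ball_le hu hC (A := ball 0 R) (B := ball 0 (R + ‖y‖)) measurableSet_ball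
    (ball_subset_ball (by simp)) measure_ball_lt_top
  rw [Measure.addHaar_ball_center _ y] at h1
  change _ ≤ C * (bv d _ - bv d R) at h1
  change _ ≤ C * (bv d _ - bv d R) at h2
  have h3 : ‖(∫ t in ball y R, u t) - ∫ t in ball 0 R, u t‖ ≤ 2 * C * (bv d (R + ‖y‖) - bv d R) := by
    have : (∫ t in ball y R, u t) - ∫ t in ball 0 R, u t =
      ((∫ t in ball 0 (R + ‖y‖), u t) - ∫ t in ball 0 R, u t) -
      ((∫ t in ball 0 (R + ‖y‖), u t) - ∫ t in ball y R, u t) := by ring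
    rw [this]
    refine (norm_sub_le _ _).trans ?_
    linarith
  have h4 : bv d (R + ‖y‖) - bv d R = bv d R * bet d R ‖y‖ := by
    rw [bv_eq hRy, bv_eq hR, bet, div_pow]
    have : R ^ d ≠ 0 := by positivity
    field_simp
  rw [h4] at h3
  rw [norm_inv, Real.norm_of_nonneg hv.le]
  calc (bv d R)⁻¹ * _ ≤ (bv d R)⁻¹ * (2 * C * (bv d R * bet d R ‖y‖)) := by gcongr
    _ = _ := by field_simp

lemma Mn_norm_le {u : VV d → ℂ} {C : ℝ} (hC : ∀ t, ‖u t‖ ≤ C)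
    {R : ℝ} (hR : 0 < R) (y : VV d) : ‖Mn R y u‖ ≤ C := by
  have hv := bv_pos (d := d) hR
  unfold Mn
  have h2 := norm_setIntegral_le_of_norm_le_const (μ := volume) (s := ball (0 : VV d) R)
    (f := fun t => u (y + t)) (C := C) measure_ball_lt_top (fun t _ => hC _)
  rw [norm_smul, norm_inv, Real.norm_of_nonneg hv.le, inv_mul_le_iff₀ hv, mul_comm]
  exact h2

lemma Mn_sub {u w : VV d → ℂ} (hu : Continuous u) (hw : Continuous w) {C C' : ℝ}
    (hC : ∀ t, ‖u t‖ ≤ C) (hC' : ∀ t, ‖w t‖ ≤ C') (R : ℝ) (y : VV d) :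
    Mn R y (fun t => u t - w t) = Mn R y u - Mn R y w := by
  unfold Mn
  rw [← smul_sub, ← integral_sub]
  · exact integrableOn_of_bdd (by fun_prop) (fun t => hC _) measure_ball_lt_top
  · exact integrableOn_of_bdd (by fun_prop) (fun t => hC' _) measure_ball_lt_top

lemma Mn_mul (a : ℂ) (u : VV d → ℂ) (R : ℝ) (y : VV d) :
    Mn R y (fun t => a * u t) = a * Mn R y u := by
  unfold Mn
  rw [integral_const_mul]
  simp only [Complex.real_smul]
  ring

lemma Mn_shift (u : VV d → ℂ) (R : ℝ) (x y : VV d) :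
    Mn R x (fun t => u (y + t)) = Mn R (y + x) u := by
  unfold Mn
  simp only [add_assoc]

lemma Mn_const {R : ℝ} (hR : 0 < R) (y : VV d) (a : ℂ) : Mn R y (fun _ => a) = a := by
  have hv := bv_pos (d := d) hR
  unfold Mn
  rw [setIntegral_const, smul_smul]
  change ((bv d R)⁻¹ * bv d R) • a = a
  rw [inv_mul_cancel₀ hv.ne', one_smul]

lemma Mn_Mn {u : VV d → ℂ} (hu : Continuous u) {C : ℝ} (hC : ∀ t, ‖u t‖ ≤ C)
    (R r : ℝ) :
    Mn R 0 (fun x => Mn r x u) = Mn r 0 (fun t => Mn R t u) := by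
  unfold Mn
  simp only [zero_add]
  rw [integral_smul, integral_smul, smul_smul, smul_smul, mul_comm]
  congr 1
  rw [integral_integral_swap]
  · simp only [add_comm]
  · have : IsFiniteMeasure (volume.restrict (ball (0:VV d) R)) := ⟨by simpa using measure_ball_lt_top⟩
    have : IsFiniteMeasure (volume.restrict (ball (0:VV d) r)) := ⟨by simpa using measure_ball_lt_top⟩
    refine Integrable.of_bound (C := C) ?_ (Eventually.of_forall fun p => hC _)
    exact Continuous.aestronglyMeasurable (by fun_prop)

lemma Mn_continuous {u : VV d → ℂ} (hu : Continuous u) {C : ℝ} (hC : ∀ t, ‖u t‖ ≤ C)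
    (R : ℝ) : Continuous (fun x => Mn R x u) := by
  unfold Mn
  refine Continuous.const_smul (M := ℝ) (g := fun x => ∫ t in ball (0 : VV d) R, u (x + t)) ?_ _
  have : IsFiniteMeasure (volume.restrict (ball (0:VV d) R)) := ⟨by simpa using measure_ball_lt_top⟩
  refine continuous_of_dominated (bound := fun _ => C) ?_ ?_ ?_ ?_
  · intro x; exact Continuous.aestronglyMeasurable (by fun_prop)
  · intro x; exact Eventually.of_forall fun t => hC _
  · exact integrable_const _
  · exact Eventually.of_forall fun t => by fun_prop

lemma Mn_avg {u : VV d → ℂ} (hu : Continuous u) {C : ℝ} (hC : ∀ t, ‖u t‖ ≤ C)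
    {R r κ : ℝ} (hR : 0 < R) (hr : 0 < r) (hκ : ∀ x, ‖Mn r x u‖ ≤ κ) :
    ‖Mn R 0 u‖ ≤ κ + 2 * C * bet d R r := by
  have hC0 : 0 ≤ C := (norm_nonneg _).trans (hC 0)
  have h1 : ‖Mn r 0 (fun t => Mn R t u)‖ ≤ κ := by
    rw [← Mn_Mn hu hC]; exact Mn_norm_le hκ hR 0
  have h2 : ‖Mn r 0 (fun t => Mn R t u) - Mn r (0 : VV d) (fun _ => Mn R 0 u)‖ ≤ 2 * C * bet d R r := by
    unfold Mn
    rw [← smul_sub]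
    have hv := bv_pos (d := d) hr
    rw [← integral_sub]
    rotate_left
    · exact integrableOn_of_bdd (C := C) ((Mn_continuous hu hC R).comp (by fun_prop))
        (fun t => Mn_norm_le hC hR _) measure_ball_lt_top
    · exact integrableOn_of_bdd continuous_const (fun t => le_rfl) measure_ball_lt_top
    have h3 := norm_setIntegral_le_of_norm_le_const (μ := volume) (s := ball (0 : VV d) r)
      (f := fun t => Mn R (0 + t) u - Mn R 0 u) (C := 2 * C * bet d R r) measure_ball_lt_top ?_
    · rw [norm_smul, norm_inv, Real.norm_of_nonneg hv.le, inv_mul_le_iff₀ hv, mul_comm]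
      exact h3
    · intro t ht
      refine (Mn_bdry hu hC hR _).trans ?_
      have : ‖t‖ ≤ r := by simpa using (mem_ball_zero_iff.1 ht).le
      have := bet_mono (d := d) hR (norm_nonneg t) this
      rw [zero_add]; gcongr
  rw [Mn_const hr] at h2
  have := norm_sub_norm_le (Mn R 0 u) (Mn r 0 (fun t => Mn R t u))
  rw [norm_sub_rev] at this
  linarith
end basics

section unif
variable {d : ℕ}

lemma ap_unifcont {D : VV d → ℂ} (hD : Continuous D) (hap : APer D) {ε : ℝ} (hε : 0 < ε) :
    ∃ δ : ℝ, 0 < δ ∧ ∀ y, ‖y‖ ≤ δ → ∀ t, ‖D (t + y) - D t‖ ≤ ε := by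
  obtain ⟨L, hL, hs⟩ := hap (ε / 3) (by positivity)
  have huc := (isCompact_closedBall (0 : VV d) (L + 1)).uniformContinuousOn_of_continuous
    hD.continuousOn
  rw [Metric.uniformContinuousOn_iff] at huc
  obtain ⟨δ, hδ, h⟩ := huc (ε / 3) (by positivity)
  refine ⟨min (δ / 2) 1, by positivity, fun y hy t => ?_⟩
  obtain ⟨s, hs1, hs2⟩ := hs (-t)
  have hy1 : ‖y‖ ≤ δ / 2 := hy.trans (min_le_left _ _)
  have hy2 : ‖y‖ ≤ 1 := hy.trans (min_le_right _ _)
  have e1 := hs2 (t + y)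
  have e2 := hs2 t
  have hts : ‖t + s‖ ≤ L := by rw [add_comm]; simpa using hs1
  have e3 := h (t + y + s) (by
    rw [mem_closedBall_zero_iff]
    calc ‖t + y + s‖ = ‖(t + s) + y‖ := by congr 1; abel
      _ ≤ _ := (norm_add_le _ _).trans (by linarith)) (t + s) (by
    rw [mem_closedBall_zero_iff]; linarith) (by
    rw [dist_eq_norm]
    have : t + y + s - (t + s) = y := by abel
    rw [this]; linarith)
  rw [dist_eq_norm] at e3
  have : D (t + y) - D t = -(D (t + y + s) - D (t + y)) + (D (t + y + s) - D (t + s))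
    + (D (t + s) - D t) := by ring
  rw [this]
  refine (norm_add₃_le).trans ?_
  rw [norm_neg]; linarith

lemma Mn_norm_le' {u : VV d → ℂ} {C : ℝ} {R : ℝ} (hR : 0 < R) (y : VV d)
    (hC : ∀ t, ‖t‖ < R → ‖u (y + t)‖ ≤ C) : ‖Mn R y u‖ ≤ C := by
  have hv := bv_pos (d := d) hR
  unfold Mn
  have h2 := norm_setIntegral_le_of_norm_le_const (μ := volume) (s := ball (0 : VV d) R)
    (f := fun t => u (y + t)) (C := C) measure_ball_lt_top
    (fun t ht => hC _ (mem_ball_zero_iff.1 ht))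
  rw [norm_smul, norm_inv, Real.norm_of_nonneg hv.le, inv_mul_le_iff₀ hv, mul_comm]
  exact h2

lemma unif_large {D : VV d → ℂ} (hD : Continuous D) (hap : APer D) {C : ℝ}
    (hC : ∀ t, ‖D t‖ ≤ C) {κ : ℝ} (hκ : 0 < κ) :
    ∃ ρ R₀ : ℝ, 0 < R₀ ∧ ∀ χ : VV d, ρ ≤ ‖χ‖ → ∀ R, R₀ ≤ R →
      ‖Mn R 0 (fun t => D t * ec χ t)‖ ≤ κ := by
  obtain ⟨δ, hδ, h⟩ := ap_unifcont hD hap hκ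
  have hC0 : 0 ≤ C := (norm_nonneg _).trans (hC 0)
  have hev : ∀ᶠ R in atTop, 2 * C * bet d R δ < κ := by
    have := (bet_tendsto (d := d) δ).const_mul (2 * C)
    rw [mul_zero] at this
    exact this.eventually_lt_const hκ
  obtain ⟨R₁, hR₁⟩ := eventually_atTop.1 hev
  refine ⟨1 / (2 * δ), max R₁ 1, by positivity, fun χ hχ R hR => ?_⟩
  have hR0 : 0 < R := lt_of_lt_of_le (by positivity) hR
  have hχ0 : 0 < ‖χ‖ := lt_of_lt_of_le (by positivity) hχ
  set s : VV d := (1 / (2 * ‖χ‖ ^ 2)) • χ with hs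
  have hsn : ‖s‖ ≤ δ := by
    rw [hs, norm_smul, Real.norm_of_nonneg (by positivity)]
    have : 1 / (2 * ‖χ‖ ^ 2) * ‖χ‖ = 1 / (2 * ‖χ‖) := by field_simp
    rw [this, div_le_iff₀ (by positivity)]
    rw [div_le_iff₀ (by positivity)] at hχ
    linarith
  have hes : ec χ s = -1 := by
    have : (2 * Real.pi * ⟪χ, s⟫ : ℝ) = Real.pi := by
      rw [hs, inner_smul_right, real_inner_self_eq_norm_sq]; field_simp
    rw [ec, this, Complex.exp_pi_mul_I]
  set u : VV d → ℂ := fun t => D t * ec χ t with hu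
  have huc : Continuous u := by fun_prop
  have hub : ∀ t, ‖u t‖ ≤ C := fun t => by simp [hu, norm_ec, hC]
  have h1 : ‖Mn R s u + Mn R 0 u‖ ≤ κ := by
    have : Mn R s u + Mn R 0 u = Mn R 0 (fun t => u (s + t) - (-1) * u t) := by
      rw [Mn_sub (u := fun t => u (s + t)) (w := fun t => (-1) * u t) (C := C) (C' := C)
        (by fun_prop) (by fun_prop) (fun t => hub _) (fun t => by simpa using hub t), Mn_mul,
        Mn_shift]
      simp
    rw [this]
    refine Mn_norm_le (fun t => ?_) hR0 _
    have : u (s + t) - (-1) * u t = - ((D (t + s) - D t) * ec χ t) := by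
      simp only [hu, ec_add, hes, add_comm s t]; ring
    rw [this, norm_neg, norm_mul, norm_ec, mul_one]
    exact h s hsn t
  have h2 := Mn_bdry huc hub hR0 s
  have h3 := bet_mono (d := d) hR0 (norm_nonneg s) hsn
  have h4 := hR₁ R ((le_max_left _ _).trans hR)
  have h5 : 2 * C * bet d R ‖s‖ ≤ 2 * C * bet d R δ := by gcongr
  have h6 : ‖Mn R 0 u + Mn R 0 u‖ ≤ κ + κ := by
    have : Mn R 0 u + Mn R 0 u = (Mn R s u + Mn R 0 u) - (Mn R s u - Mn R 0 u) := by ring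
    rw [this]
    refine (norm_sub_le _ _).trans (by linarith)
  rw [← two_mul, norm_mul] at h6
  simp at h6
  linarith

lemma unif_x {D : VV d → ℂ} (hD : Continuous D) (hap : APer D) {C : ℝ}
    (hC : ∀ t, ‖D t‖ ≤ C) (χ : VV d)
    (h0 : Tendsto (fun R => Mn R 0 (fun t => D t * ec χ t)) atTop (𝓝 0)) {κ : ℝ} (hκ : 0 < κ) :
    ∃ r : ℝ, 0 < r ∧ ∀ x, ‖Mn r x (fun t => D t * ec χ t)‖ ≤ κ := by
  have hC0 : 0 ≤ C := (norm_nonneg _).trans (hC 0)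
  obtain ⟨L, hL, hs⟩ := hap (κ / 3) (by positivity)
  have hev : ∀ᶠ R in atTop, 2 * C * bet d R L < κ / 3 := by
    have := (bet_tendsto (d := d) L).const_mul (2 * C)
    rw [mul_zero] at this
    exact this.eventually_lt_const (by positivity)
  have hev2 := (tendsto_zero_iff_norm_tendsto_zero.1 h0).eventually_lt_const
    (by positivity : 0 < κ / 3)
  obtain ⟨r, hr1, hr2, hr⟩ := (hev.and (hev2.and (eventually_gt_atTop 0))).exists
  refine ⟨r, hr, fun x => ?_⟩
  obtain ⟨s, hs1, hs2⟩ := hs x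
  set u : VV d → ℂ := fun t => D t * ec χ t with hu
  have huc : Continuous u := by fun_prop
  have hub : ∀ t, ‖u t‖ ≤ C := fun t => by simp [hu, norm_ec, hC]
  have e1 := Mn_bdry huc hub hr (x - s)
  have e2 := bet_mono (d := d) hr (z := L) (norm_nonneg (x - s)) (by rwa [norm_sub_rev])
  have e3 : 2 * C * bet d r ‖x - s‖ ≤ 2 * C * bet d r L := by gcongr
  have e4 : ‖Mn r x u - ec χ s * Mn r (x - s) u‖ ≤ κ / 3 := by
    have : Mn r x u - ec χ s * Mn r (x - s) u
        = Mn r (x - s) (fun t => u (s + t) - ec χ s * u t) := by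
      rw [Mn_sub (u := fun t => u (s + t)) (w := fun t => ec χ s * u t) (C := C) (C' := C)
        (by fun_prop) (by fun_prop) (fun t => hub _)
        (fun t => by simpa [norm_ec] using hub t), Mn_mul, Mn_shift]
      simp
    rw [this]
    refine Mn_norm_le (fun t => ?_) hr _
    have : u (s + t) - ec χ s * u t = ((D (t + s) - D t) * (ec χ s * ec χ t)) := by
      simp only [hu, ec_add, add_comm s t]; ring
    rw [this, norm_mul, norm_mul, norm_ec, norm_ec]
    simpa using hs2 t
  have e5 : ‖Mn r (x - s) u‖ ≤ κ / 3 + κ / 3 := by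
    have : Mn r (x - s) u = (Mn r (x - s) u - Mn r 0 u) + Mn r 0 u := by ring
    rw [this]
    refine (norm_add_le _ _).trans (by linarith)
  have : Mn r x u = (Mn r x u - ec χ s * Mn r (x - s) u) + ec χ s * Mn r (x - s) u := by ring
  rw [this]
  refine (norm_add_le _ _).trans ?_
  rw [norm_mul, norm_ec]; linarith

lemma unif_local {D : VV d → ℂ} (hD : Continuous D) (hap : APer D) {C : ℝ}
    (hC : ∀ t, ‖D t‖ ≤ C) (χ₀ : VV d)
    (h0 : Tendsto (fun R => Mn R 0 (fun t => D t * ec χ₀ t)) atTop (𝓝 0)) {κ : ℝ} (hκ : 0 < κ) :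
    ∃ R₀ : ℝ, 0 < R₀ ∧ ∀ᶠ χ in 𝓝 χ₀, ∀ R, R₀ ≤ R →
      ‖Mn R 0 (fun t => D t * ec χ t)‖ ≤ κ := by
  have hC0 : 0 ≤ C := (norm_nonneg _).trans (hC 0)
  obtain ⟨r, hr, hx⟩ := unif_x hD hap hC χ₀ h0 (κ := κ / 3) (by positivity)
  have hev : ∀ᶠ R in atTop, 2 * C * bet d R r < κ / 3 := by
    have := (bet_tendsto (d := d) r).const_mul (2 * C)
    rw [mul_zero] at this
    exact this.eventually_lt_const (by positivity)
  obtain ⟨R₁, hR₁⟩ := eventually_atTop.1 hev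
  refine ⟨max R₁ 1, by positivity, ?_⟩
  have hnear : ∀ᶠ χ in 𝓝 χ₀, C * (2 * Real.pi * ‖χ - χ₀‖ * r) < κ / 3 := by
    have : Tendsto (fun χ => C * (2 * Real.pi * ‖χ - χ₀‖ * r)) (𝓝 χ₀)
        (𝓝 (C * (2 * Real.pi * ‖χ₀ - χ₀‖ * r))) :=
      Continuous.tendsto (by fun_prop) χ₀
    simp only [sub_self, norm_zero, mul_zero, zero_mul] at this
    exact this.eventually_lt_const (by positivity)
  filter_upwards [hnear] with χ hχ R hR
  have hR0 : 0 < R := lt_of_lt_of_le (by positivity) hR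
  have key : ∀ x, ‖Mn r x (fun t => D t * ec χ t)‖ ≤ κ / 3 + κ / 3 := by
    intro x
    have e1 : ∀ ψ : VV d, Mn r x (fun t => D t * ec ψ t) =
        ec ψ x * Mn r 0 (fun t => D (x + t) * ec ψ t) := by
      intro ψ
      rw [← Mn_mul]
      have := Mn_shift (fun t => D t * ec ψ t) r 0 x
      rw [add_zero] at this
      rw [← this]
      congr 1; ext t; rw [ec_add]; ring
    have e2 := hx x
    rw [e1, norm_mul, norm_ec, one_mul] at e2 ⊢
    have e3 : ‖Mn r 0 (fun t => D (x + t) * ec χ t) - Mn r 0 (fun t => D (x + t) * ec χ₀ t)‖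
        ≤ κ / 3 := by
      rw [← Mn_sub (C := C) (C' := C) (by fun_prop) (by fun_prop)
        (fun t => by simp [norm_ec, hC]) (fun t => by simp [norm_ec, hC])]
      refine Mn_norm_le' hr _ (fun t ht => ?_)
      rw [zero_add, ← mul_sub, norm_mul]
      refine le_trans ?_ hχ.le
      gcongr
      · exact hC _
      · refine (ec_sub_le χ χ₀ t).trans ?_
        gcongr
    have := norm_sub_norm_le (Mn r 0 (fun t => D (x + t) * ec χ t))
      (Mn r 0 (fun t => D (x + t) * ec χ₀ t))
    linarith
  have := Mn_avg (u := fun t => D t * ec χ t) (by fun_prop) (C := C)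
    (fun t => by simp [norm_ec, hC]) hR0 hr key
  have := hR₁ R ((le_max_left _ _).trans hR)
  linarith

lemma unif_small {D : VV d → ℂ} (hD : Continuous D) (hap : APer D) {C : ℝ}
    (hC : ∀ t, ‖D t‖ ≤ C)
    (h0 : ∀ χ, Tendsto (fun R => Mn R 0 (fun t => D t * ec χ t)) atTop (𝓝 0)) {κ : ℝ} (hκ : 0 < κ) :
    ∃ R₀ : ℝ, 0 < R₀ ∧ ∀ χ : VV d, ∀ R, R₀ ≤ R →
      ‖Mn R 0 (fun t => D t * ec χ t)‖ ≤ κ := by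
  obtain ⟨ρ, R₁, hR₁, h1⟩ := unif_large hD hap hC hκ
  have h2 : ∃ R₀ : ℝ, 0 < R₀ ∧ ∀ χ ∈ closedBall (0 : VV d) ρ, ∀ R, R₀ ≤ R →
      ‖Mn R 0 (fun t => D t * ec χ t)‖ ≤ κ := by
    refine (isCompact_closedBall (0 : VV d) ρ).induction_on
      (p := fun S => ∃ R₀ : ℝ, 0 < R₀ ∧ ∀ χ ∈ S, ∀ R, R₀ ≤ R →
      ‖Mn R 0 (fun t => D t * ec χ t)‖ ≤ κ) ?_ ?_ ?_ ?_
    · exact ⟨1, one_pos, by simp⟩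
    · rintro S T hST ⟨R₀, h, h'⟩
      exact ⟨R₀, h, fun χ hχ => h' χ (hST hχ)⟩
    · rintro S T ⟨R₀, h, h'⟩ ⟨R₂, g, g'⟩
      refine ⟨max R₀ R₂, by positivity, fun χ hχ R hR => ?_⟩
      rcases hχ with hχ | hχ
      · exact h' χ hχ R ((le_max_left _ _).trans hR)
      · exact g' χ hχ R ((le_max_right _ _).trans hR)
    · intro χ₀ _
      obtain ⟨R₀, h, h'⟩ := unif_local hD hap hC χ₀ (h0 χ₀) hκ
      exact ⟨_, mem_nhdsWithin_of_mem_nhds h', R₀, h, fun χ hχ => hχ⟩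
  obtain ⟨R₂, hR₂, h2⟩ := h2
  refine ⟨max R₁ R₂, by positivity, fun χ R hR => ?_⟩
  rcases le_total ρ ‖χ‖ with hχ | hχ
  · exact h1 χ hχ R ((le_max_left _ _).trans hR)
  · exact h2 χ (by simpa using hχ) R ((le_max_right _ _).trans hR)
end unif

section uniq
variable {d : ℕ}

@[fun_prop]
lemma continuous_ec2 : Continuous (fun p : VV d × VV d => ec p.1 p.2) := by
  unfold ec; fun_prop

lemma continuous_fourierInv {U : VV d → ℂ} (hU : Integrable U) :
    Continuous (𝓕⁻ U) := by
  have : 𝓕⁻ U = fun w => ∫ v, U v * ec w v := by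
    ext w; exact fourierInv_eq_ec U w
  rw [this]
  refine continuous_of_dominated (bound := fun v => ‖U v‖) ?_ ?_ hU.norm ?_
  · intro w; exact hU.1.mul (continuous_ec w).aestronglyMeasurable
  · intro w; exact Eventually.of_forall fun v => by simp [norm_ec]
  · exact Eventually.of_forall fun v => by fun_prop

lemma bilin_bound (V : SchwartzMap (VV d) ℂ) {U : VV d → ℂ} (hU : Integrable U) {A : ℝ}
    (hA : ∀ ξ, ‖𝓕⁻ U ξ‖ ≤ A) :
    ‖∫ s, V s * ∫ x, U x * V (x - s)‖ ≤ A * ∫ x, ‖V x‖ ^ 2 := by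
  set W : SchwartzMap (VV d) ℂ := 𝓕 V with hW
  have hinv : ∀ y, V y = ∫ ξ, W ξ * ec ξ y := by
    intro y
    have h1 : 𝓕⁻ W = V := by rw [hW]; simp
    have h2 : V y = 𝓕⁻ (W : VV d → ℂ) y := by
      rw [← SchwartzMap.fourierInv_coe, h1]
    rw [h2, fourierInv_eq_ec]
    refine integral_congr_ae (Eventually.of_forall fun v => ?_)
    simp only [ec, real_inner_comm]
  have hWV : ∀ ξ, W ξ = ∫ s, V s * ec ξ (-s) := by
    intro ξ
    have h2 : W ξ = 𝓕 (V : VV d → ℂ) ξ := by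
      rw [hW, SchwartzMap.fourier_coe]
    rw [h2, fourier_eq_ec]
    simp only [ec_neg_left]
  have hWi : Integrable W := W.integrable
  have hUc := continuous_fourierInv hU
  have s1 : ∀ s, ∫ x, U x * V (x - s) = ∫ ξ, W ξ * 𝓕⁻ U ξ * ec ξ (-s) := by
    intro s
    simp_rw [hinv, ← integral_const_mul]
    rw [integral_integral_swap]
    · refine integral_congr_ae (Eventually.of_forall fun ξ => ?_)
      simp only [fourierInv_eq_ec]
      rw [mul_assoc, mul_comm (∫ v, _), ← integral_const_mul, ← integral_const_mul]
      refine integral_congr_ae (Eventually.of_forall fun x => ?_)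
      simp only [sub_eq_add_neg, ec_add]; ring
    · refine (hU.mul_prod hWi).norm.mono' ?_ (Eventually.of_forall fun p => ?_)
      · have : (Function.uncurry fun x ξ => U x * (W ξ * ec ξ (x - s))) =
          fun p : VV d × VV d => (U p.1 * W p.2) * ec p.2 (p.1 - s) := by
          ext p; simp [Function.uncurry, mul_assoc]
        rw [this]
        exact (hU.mul_prod hWi).1.mul (Continuous.aestronglyMeasurable
          (continuous_ec2.comp (f := fun p : VV d × VV d => (p.2, p.1 - s)) (by fun_prop)))
      · simp [Function.uncurry, norm_ec]
  have hWU : Integrable (fun ξ => W ξ * 𝓕⁻ U ξ) :=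
    hWi.mul_bdd (c := A) hUc.aestronglyMeasurable (Eventually.of_forall hA)
  have s2 : ∫ s, V s * ∫ x, U x * V (x - s) = ∫ ξ, W ξ * 𝓕⁻ U ξ * W ξ := by
    simp_rw [s1, ← integral_const_mul]
    rw [integral_integral_swap]
    · refine integral_congr_ae (Eventually.of_forall fun ξ => ?_)
      simp only []
      conv_rhs => rw [hWV ξ, ← hWV ξ]
      nth_rewrite 3 [hWV ξ]
      rw [← integral_const_mul]
      refine integral_congr_ae (Eventually.of_forall fun x => ?_)
      simp only []; ring
    · refine ((V.integrable (μ := volume)).mul_prod hWU).norm.mono' ?_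
        (Eventually.of_forall fun p => ?_)
      · have : (Function.uncurry fun s ξ => V s * (W ξ * 𝓕⁻ U ξ * ec ξ (-s))) =
          fun p : VV d × VV d => (V p.1 * (W p.2 * 𝓕⁻ U p.2)) * ec p.2 (-p.1) := by
          ext p; simp [Function.uncurry, mul_assoc]
        rw [this]
        exact ((V.integrable (μ := volume)).mul_prod hWU).1.mul (Continuous.aestronglyMeasurable
          (continuous_ec2.comp (f := fun p : VV d × VV d => (p.2, -p.1)) (by fun_prop)))
      · simp [Function.uncurry, norm_ec]
  rw [s2, ← SchwartzMap.integral_norm_sq_fourier V, ← integral_const_mul]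
  have hW2 : Integrable (fun ξ => ‖W ξ‖ ^ 2) := by
    have := (W.memLp 2 volume).integrable_norm_pow (p := 2) (by norm_num)
    simpa using this
  refine norm_integral_le_of_norm_le (hW2.const_mul A) (Eventually.of_forall fun ξ => ?_)
  rw [norm_mul, norm_mul]
  have := hA ξ
  calc ‖W ξ‖ * ‖𝓕⁻ U ξ‖ * ‖W ξ‖ = ‖𝓕⁻ U ξ‖ * ‖W ξ‖ ^ 2 := by ring
    _ ≤ _ := by gcongr

lemma uniq_core {D : VV d → ℂ} (hD : Continuous D) {C : ℝ} (hC : ∀ t, ‖D t‖ ≤ C)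
    {v : VV d → ℝ} (hv0 : ∀ s, 0 ≤ v s) (hvs : ContDiff ℝ ((⊤ : ℕ∞) : WithTop ℕ∞) v)
    (hvc : HasCompactSupport v) {R ε κ : ℝ} (hR : 0 < R)
    (hv : ∀ s, v s ≠ 0 → ‖s‖ < R / 2 ∧ ∀ t, ‖D (t + s) - D t‖ ≤ ε)
    (hκ : ∀ χ : VV d, ‖Mn R 0 (fun t => D t * ec χ t)‖ ≤ κ) :
    ‖D 0‖ * (∫ s, v s) ^ 2 ≤ 2 * ε * (∫ s, v s) ^ 2 + κ * bv d R * ∫ s, v s ^ 2 := by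
  have hvC : HasCompactSupport (fun s => (v s : ℂ)) := hvc.comp_left (g := fun x : ℝ => (x : ℂ)) (by simp)
  have hvCs : ContDiff ℝ ((⊤ : ℕ∞) : WithTop ℕ∞) (fun s => (v s : ℂ)) := Complex.ofRealCLM.contDiff.comp hvs
  set V : SchwartzMap (VV d) ℂ := hvC.toSchwartzMap hvCs with hVdef
  have hV : ∀ s, V s = (v s : ℂ) := fun s => rfl
  set U : VV d → ℂ := (ball (0 : VV d) R).indicator D with hU
  have hvi : Integrable v := hvs.continuous.integrable_of_hasCompactSupport hvc
  have hviC : Integrable (fun s => (v s : ℂ)) := hvi.ofReal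
  have hUi : Integrable U := by
    rw [hU, integrable_indicator_iff measurableSet_ball]
    exact integrableOn_of_bdd hD hC measure_ball_lt_top
  have hbv := bv_pos (d := d) hR
  have hA : ∀ ξ, ‖𝓕⁻ U ξ‖ ≤ κ * bv d R := by
    intro ξ
    have h := hκ ξ
    have e : 𝓕⁻ U ξ = ∫ t in ball (0 : VV d) R, D t * ec ξ t := by
      rw [fourierInv_eq_ec, ← integral_indicator measurableSet_ball]
      refine integral_congr_ae (Eventually.of_forall fun t => ?_)
      by_cases ht : t ∈ ball (0 : VV d) R <;> simp [hU, ht]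
    unfold Mn at h
    simp only [zero_add] at h
    rw [norm_smul, norm_inv, Real.norm_of_nonneg hbv.le, inv_mul_le_iff₀ hbv] at h
    rw [e]; linarith
  have h1 := bilin_bound V hUi hA
  have h2 : ∫ x, ‖V x‖ ^ 2 = ∫ s, v s ^ 2 := by
    refine integral_congr_ae (Eventually.of_forall fun t => ?_)
    simp [hV]
  rw [h2] at h1
  have hshift : ∀ s, ∫ x, U x * V (x - s) = ∫ y, U (y + s) * v y := by
    intro s
    rw [← integral_add_right_eq_self _ s]
    simp [hV]
  simp_rw [hshift] at h1
  have hUb : ∀ t, ‖U t‖ ≤ C := fun t => (norm_indicator_le_norm_self D t).trans (hC t)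
  have hI1 : ∀ s, Integrable (fun y => U (y + s) * (v y : ℂ)) := by
    intro s
    refine hviC.bdd_mul (c := C) ?_ (Eventually.of_forall fun y => hUb _)
    exact (hUi.comp_add_right s).1
  have key : ∀ s, ‖V s * (∫ y, U (y + s) * v y) - V s * (D 0 * ((∫ y, v y : ℝ) : ℂ))‖ ≤
      2 * ε * (∫ y, v y) * v s := by
    intro s
    by_cases hs : v s = 0
    · simp [hV, hs]
    rw [← mul_sub, norm_mul, hV, Complex.norm_real, Real.norm_of_nonneg (hv0 s), mul_comm]
    refine mul_le_mul_of_nonneg_right ?_ (hv0 s)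
    rw [← integral_complex_ofReal (f := v), ← integral_const_mul, ← integral_sub (hI1 s)
      (hviC.const_mul _), ← integral_const_mul]
    refine norm_integral_le_of_norm_le (hvi.const_mul _) (Eventually.of_forall fun y => ?_)
    by_cases hy : v y = 0
    · simp [hy]
    obtain ⟨hs1, hs2⟩ := hv s hs
    obtain ⟨hy1, hy2⟩ := hv y hy
    have hmem : y + s ∈ ball (0 : VV d) R := by
      rw [mem_ball_zero_iff]
      exact (norm_add_le _ _).trans_lt (by linarith)
    have : U (y + s) = D (y + s) := by simp only [hU]; exact Set.indicator_of_mem hmem D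
    rw [this, ← sub_mul, norm_mul, Complex.norm_real, Real.norm_of_nonneg (hv0 y)]
    refine mul_le_mul_of_nonneg_right ?_ (hv0 y)
    have a1 := hs2 y
    have a2 := hy2 0
    rw [zero_add] at a2
    have : D (y + s) - D 0 = (D (y + s) - D y) + (D y - D 0) := by ring
    rw [this]
    refine (norm_add_le _ _).trans (by linarith)
  have hJ : Integrable (fun s => V s * (D 0 * ((∫ y, v y : ℝ) : ℂ))) := (V.integrable).mul_const _
  have hdiff : ‖(∫ s, V s * (∫ y, U (y + s) * v y)) - ∫ s, V s * (D 0 * ((∫ y, v y : ℝ) : ℂ))‖ ≤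
      2 * ε * (∫ y, v y) ^ 2 := by
    rw [← integral_sub _ hJ]
    · have := norm_integral_le_of_norm_le (hvi.const_mul (2 * ε * ∫ y, v y))
        (Eventually.of_forall key)
      rw [integral_const_mul] at this
      refine this.trans (le_of_eq (by ring))
    · have hm : AEStronglyMeasurable (fun s => ∫ y, U (y + s) * (v y : ℂ)) volume := by
        have hDm : StronglyMeasurable U := hD.stronglyMeasurable.indicator measurableSet_ball
        refine StronglyMeasurable.aestronglyMeasurable ?_
        refine StronglyMeasurable.integral_prod_right'
          (f := fun p : VV d × VV d => U (p.2 + p.1) * (v p.2 : ℂ)) ?_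
        refine (hDm.comp_measurable (by fun_prop)).mul ?_
        have : Continuous (fun p : VV d × VV d => (v p.2 : ℂ)) :=
          hvCs.continuous.comp continuous_snd
        exact this.stronglyMeasurable
      refine (V.integrable (μ := volume)).mul_bdd (c := C * ∫ y, v y) hm
        (Eventually.of_forall fun s => ?_)
      rw [← integral_const_mul]
      refine norm_integral_le_of_norm_le (hvi.const_mul _) (Eventually.of_forall fun y => ?_)
      rw [norm_mul, Complex.norm_real, Real.norm_of_nonneg (hv0 y)]
      exact mul_le_mul_of_nonneg_right (hUb _) (hv0 y)
  have e : ∫ s, V s * (D 0 * ((∫ y, v y : ℝ) : ℂ)) = D 0 * ((∫ y, v y : ℝ) : ℂ) ^ 2 := by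
    rw [integral_mul_const]
    simp only [hV, integral_complex_ofReal]; ring
  rw [e] at hdiff
  have hn : ‖D 0 * ((∫ y, v y : ℝ) : ℂ) ^ 2‖ = ‖D 0‖ * (∫ s, v s) ^ 2 := by
    rw [norm_mul, norm_pow, Complex.norm_real, Real.norm_eq_abs, sq_abs]
  rw [← hn]
  have := norm_sub_norm_le (D 0 * ((∫ y, v y : ℝ) : ℂ) ^ 2) (∫ s, V s * (∫ y, U (y + s) * v y))
  rw [norm_sub_rev] at this
  linarith
end uniq

section uniq2
variable {d : ℕ}

def latt (d : ℕ) (L : ℝ) {n : ℕ} (k : Fin d → Fin n) : VV d :=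
  WithLp.toLp 2 (fun i => 4 * L * ((k i : ℕ) : ℝ))

lemma latt_sep {L : ℝ} (hL : 1 ≤ L) {n : ℕ} {k l : Fin d → Fin n} (hkl : k ≠ l) :
    4 * L ≤ ‖latt d L k - latt d L l‖ := by
  obtain ⟨i, hi⟩ := Function.ne_iff.1 hkl
  have h1 := PiLp.norm_apply_le (latt d L k - latt d L l) i
  refine le_trans ?_ h1
  have : (latt d L k - latt d L l) i = 4 * L * (((k i : ℕ) : ℝ) - ((l i : ℕ) : ℝ)) := by
    simp [latt]; ring
  rw [this, norm_mul, Real.norm_of_nonneg (by positivity)]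
  have h2 : (1 : ℝ) ≤ ‖((k i : ℕ) : ℝ) - ((l i : ℕ) : ℝ)‖ := by
    have h3 : ((k i : ℕ) : ℤ) - ((l i : ℕ) : ℤ) ≠ 0 := by
      intro h; apply hi; ext; omega
    have := Int.one_le_abs h3
    rw [Real.norm_eq_abs]
    exact_mod_cast this
  nlinarith

lemma latt_norm {L : ℝ} (hL : 1 ≤ L) {n : ℕ} (k : Fin d → Fin n) :
    ‖latt d L k‖ ≤ 4 * L * (d + 1) * n := by
  rw [EuclideanSpace.norm_eq]
  apply Real.sqrt_le_iff.2
  refine ⟨by positivity, ?_⟩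
  have : ∀ i ∈ Finset.univ, ‖latt d L k i‖ ^ 2 ≤ (4 * L * n) ^ 2 := by
    intro i _
    have h : latt d L k i = 4 * L * ((k i : ℕ) : ℝ) := rfl
    rw [h, Real.norm_of_nonneg (by positivity)]
    have : ((k i : ℕ) : ℝ) ≤ n := by exact_mod_cast (k i).2.le
    gcongr
  refine (Finset.sum_le_card_nsmul _ _ _ this).trans ?_
  simp only [Finset.card_univ, Fintype.card_fin, nsmul_eq_mul]
  have h3 : (d : ℝ) ≤ (d + 1) ^ 2 := by nlinarith [(Nat.cast_nonneg d : (0 : ℝ) ≤ d)]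
  calc (d : ℝ) * (4 * L * n) ^ 2 ≤ (d + 1) ^ 2 * (4 * L * n) ^ 2 := by gcongr
    _ = _ := by ring

set_option maxHeartbeats 1000000 in
theorem ap_uniq {D : VV d → ℂ} (hD : Continuous D) (hap : APer D) {C : ℝ}
    (hC : ∀ t, ‖D t‖ ≤ C)
    (h0 : ∀ χ, Tendsto (fun R => Mn R 0 (fun t => D t * ec χ t)) atTop (𝓝 0)) :
    D 0 = 0 := by
  suffices H : ∀ ε : ℝ, 0 < ε → ‖D 0‖ ≤ 5 * ε by
    rw [← norm_le_zero_iff]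
    refine le_of_forall_pos_le_add fun ε hε => ?_
    have := H (ε / 5) (by positivity)
    linarith
  intro ε hε
  obtain ⟨δ', hδ', hδ⟩ := ap_unifcont hD hap hε
  obtain ⟨L', hL', hs'⟩ := hap ε hε
  set L := max L' 1 with hLdef
  have hL : 1 ≤ L := le_max_right _ _
  set δ := min δ' (1/2) with hδdef
  have hδ0 : 0 < δ := by positivity
  have hδ1 : δ ≤ 1 / 2 := min_le_right _ _
  choose σ hσ1 hσ2 using hs'
  replace hσ1 : ∀ x, ‖σ x - x‖ ≤ L := fun x => (hσ1 x).trans (le_max_left _ _)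
  let b : ContDiffBump (0 : VV d) := ⟨δ / 2, δ, by positivity, by linarith⟩
  have hbs : ∀ x, b x ≠ 0 → ‖x‖ < δ := by
    intro x hx
    have : x ∈ Function.support b := hx
    rw [b.support_eq] at this
    simpa using this
  set B := ∫ x, b x with hB
  have hBpos : 0 < B := b.integral_pos
  set Q := ∫ x, (b x) ^ 2 with hQ
  have hQ0 : 0 ≤ Q := integral_nonneg fun x => sq_nonneg _
  set A := 2 * (4 * L * (d + 1) + L + 2) with hA
  have hApos : 0 < A := by positivity
  set M := A ^ d * bv d 1 with hM
  have hM0 : 0 < M := mul_pos (by positivity) (bv_pos one_pos)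
  set κ := ε * B ^ 2 / (M * Q + 1) with hκ
  have hκ0 : 0 < κ := by positivity
  obtain ⟨R₀, hR₀, hR⟩ := unif_small hD hap hC h0 hκ0
  obtain ⟨n₀, hn₀⟩ := exists_nat_ge (R₀ / A)
  set n := max n₀ 1 with hn
  have hn1 : 1 ≤ n := le_max_right _ _
  have hn1' : (1 : ℝ) ≤ n := by exact_mod_cast hn1
  have hnR : R₀ ≤ A * n := by
    rw [div_le_iff₀ hApos] at hn₀
    have : (n₀ : ℝ) ≤ n := by exact_mod_cast le_max_left _ _
    nlinarith
  set R := A * n with hRdef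
  have hRpos : 0 < R := by positivity
  let p : (Fin d → Fin n) → VV d := fun k => σ (latt d L k)
  set v : VV d → ℝ := fun s => ∑ k, b (s - p k) with hv
  have hsep : ∀ k l, k ≠ l → ∀ s, b (s - p k) * b (s - p l) = 0 := by
    intro k l hkl s
    by_contra hne
    have h1 := hbs _ (left_ne_zero_of_mul hne)
    have h2 := hbs _ (right_ne_zero_of_mul hne)
    have h3 := latt_sep hL hkl
    have h4 := hσ1 (latt d L k)
    have h5 := hσ1 (latt d L l)
    have e : latt d L k - latt d L l = -(p k - latt d L k) + (p l - latt d L l)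
      + (s - p l) - (s - p k) := by abel
    have : ‖latt d L k - latt d L l‖ ≤ L + L + δ + δ := by
      rw [e]
      refine (norm_sub_le _ _).trans ?_
      have := norm_add₃_le (a := -(p k - latt d L k)) (b := (p l - latt d L l)) (c := (s - p l))
      rw [norm_neg] at this
      have h4' : ‖p k - latt d L k‖ ≤ L := h4
      have h5' : ‖p l - latt d L l‖ ≤ L := h5
      linarith
    linarith
  have hvsq : ∀ s, v s ^ 2 = ∑ k, b (s - p k) ^ 2 := by
    intro s
    rw [sq, hv, Finset.sum_mul_sum]
    refine Finset.sum_congr rfl fun k _ => ?_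
    rw [Finset.sum_eq_single k]
    · ring
    · intro l _ hl; exact hsep k l hl.symm s
    · simp
  have hbi : Integrable (b : VV d → ℝ) := b.integrable
  have hbi2 : Integrable (fun x => (b x : ℝ) ^ 2) := by
    refine Continuous.integrable_of_hasCompactSupport (b.continuous.pow 2) ?_
    exact b.hasCompactSupport.comp_left (g := fun x : ℝ => x ^ 2) (by simp)
  have hcard : ((Finset.univ : Finset (Fin d → Fin n)).card : ℝ) = (n : ℝ) ^ d := by
    simp
  have hIv : ∫ s, v s = (n : ℝ) ^ d * B := by
    rw [hv, integral_finsetSum _ (fun k _ => hbi.comp_sub_right (p k))]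
    simp_rw [integral_sub_right_eq_self (fun x => b x)]
    rw [Finset.sum_const, nsmul_eq_mul, hcard]
  have hIv2 : ∫ s, v s ^ 2 = (n : ℝ) ^ d * Q := by
    simp_rw [hvsq]
    rw [integral_finsetSum _ (fun k _ => hbi2.comp_sub_right (p k))]
    simp_rw [integral_sub_right_eq_self (fun x => b x ^ 2)]
    rw [Finset.sum_const, nsmul_eq_mul, hcard]
  have hvprop : ∀ s, v s ≠ 0 → ‖s‖ < R / 2 ∧ ∀ t, ‖D (t + s) - D t‖ ≤ 2 * ε := by
    intro s hs
    obtain ⟨k, _, hk⟩ := Finset.exists_ne_zero_of_sum_ne_zero hs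
    have hk := hbs _ hk
    constructor
    · have h1 := latt_norm hL k
      have h2 := hσ1 (latt d L k)
      have e : s = (s - p k) + (σ (latt d L k) - latt d L k) + latt d L k := by simp [p]
      have h3 : ‖s‖ ≤ δ + L + 4 * L * (d + 1) * n := by
        rw [e]; refine norm_add₃_le.trans ?_; linarith
      have : R / 2 = 4 * L * (d + 1) * n + L * n + 2 * n := by rw [hRdef, hA]; ring
      rw [this]
      nlinarith
    · intro t
      have h1 := hσ2 (latt d L k) (t + (s - p k))
      have h2 := hδ (s - p k) (hk.le.trans (min_le_left _ _)) t
      have e : t + s = t + (s - p k) + σ (latt d L k) := by simp only [p]; abel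
      have : D (t + s) - D t = (D (t + (s - p k) + σ (latt d L k)) - D (t + (s - p k)))
        + (D (t + (s - p k)) - D t) := by rw [← e]; ring
      rw [this]
      refine (norm_add_le _ _).trans (by linarith)
  have hcore := uniq_core hD hC (v := v) (R := R) (ε := 2 * ε) (κ := κ)
    (fun s => Finset.sum_nonneg fun k _ => b.nonneg)
    (by
      refine ContDiff.sum fun k _ => ?_
      exact b.contDiff.comp (contDiff_id.sub contDiff_const))
    (by
      refine HasCompactSupport.intro (isCompact_closedBall (0 : VV d) (R / 2)) fun x hx => ?_
      by_contra hne
      have := (hvprop x hne).1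
      exact hx (by simpa using this.le))
    hRpos hvprop (fun χ => hR χ R hnR)
  rw [hIv, hIv2, bv_eq hRpos] at hcore
  have e1 : R ^ d * bv d 1 = (n : ℝ) ^ d * M := by rw [hRdef, hM, mul_pow]; ring
  rw [e1] at hcore
  set N : ℝ := (n : ℝ) ^ d with hN
  have hN0 : 0 < N := by positivity
  have hκM : κ * (M * Q) ≤ ε * B ^ 2 := by
    rw [hκ, div_mul_eq_mul_div, div_le_iff₀ (by positivity)]
    have : 0 ≤ ε * B ^ 2 := by positivity
    nlinarith
  have h7 : ‖D 0‖ * (N * B) ^ 2 ≤ 5 * ε * (N * B) ^ 2 := by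
    have : N ^ 2 * (κ * (M * Q)) ≤ N ^ 2 * (ε * B ^ 2) := by gcongr
    calc ‖D 0‖ * (N * B) ^ 2 ≤ _ := hcore
      _ = 4 * ε * (N * B) ^ 2 + N ^ 2 * (κ * (M * Q)) := by ring
      _ ≤ 4 * ε * (N * B) ^ 2 + N ^ 2 * (ε * B ^ 2) := by gcongr
      _ = _ := by ring
  exact le_of_mul_le_mul_right h7 (by positivity)
end uniq2

section meas
variable {d : ℕ}

/-- weight -/
def wt {d : ℕ} (y : VV d) : ℝ := ((1 + ‖y‖) ^ (d + 1))⁻¹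

lemma wt_pos (y : VV d) : 0 < wt y := by unfold wt; positivity

@[fun_prop]
lemma continuous_wt : Continuous (wt : VV d → ℝ) := by
  unfold wt
  refine Continuous.inv₀ (by fun_prop) fun y => by positivity

lemma integrable_wt : Integrable (wt : VV d → ℝ) := by
  have := integrable_one_add_norm (E := VV d) (μ := volume) (r := (d : ℝ) + 1) (by simp)
  refine this.congr (Eventually.of_forall fun x => ?_)
  simp only [wt]
  rw [Real.rpow_neg (by positivity)]
  congr 1
  exact_mod_cast Real.rpow_natCast (1 + ‖x‖) (d + 1)

lemma wt_le {t x y : VV d} (h : ‖y - x‖ < 1) : wt (t - x) ≤ 2 ^ (d + 1) * wt (t - y) := by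
  unfold wt
  rw [← inv_pow, ← inv_pow, ← mul_pow]
  gcongr
  rw [← div_eq_mul_inv, inv_le_comm₀ (by positivity) (by positivity), inv_div,
    div_le_iff₀ (by positivity)]
  have : ‖t - y‖ ≤ ‖t - x‖ + ‖y - x‖ := by
    have e : t - y = (t - x) - (y - x) := by abel
    rw [e]; exact norm_sub_le _ _
  have := norm_nonneg (t - x)
  linarith

lemma wt_bound (μ : Measure (VV d)) [μ.Regular]
    (hTB : ∀ K : Set (VV d), IsCompact K → (⨆ x : VV d, μ (x +ᵥ K)) < ⊤) :
    ∃ T : ℝ, 0 < T ∧ ∀ t, Integrable (fun x => wt (t - x)) μ ∧ ∫ x, wt (t - x) ∂μ ≤ T := by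
  set Cμ := ⨆ x : VV d, μ (x +ᵥ closedBall (0 : VV d) 1) with hCμ
  have hC := hTB _ (isCompact_closedBall (0 : VV d) 1)
  have hball : ∀ y : VV d, μ (ball y 1) ≤ Cμ := by
    intro y
    refine le_trans (measure_mono ?_) (le_iSup (fun x : VV d => μ (x +ᵥ closedBall (0 : VV d) 1)) y)
    rw [vadd_closedBall]
    simpa using ball_subset_closedBall
  set v1 := volume (ball (0 : VV d) 1) with hv1
  have hv1pos : v1 ≠ 0 := (measure_ball_pos _ _ one_pos).ne'
  have hv1top : v1 ≠ ⊤ := measure_ball_lt_top.ne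
  set K : ℝ≥0∞ := (∫⁻ y : VV d, ENNReal.ofReal (2 ^ (d + 1) * wt y)) * Cμ with hK
  have hKtop : K < ⊤ := by
    refine ENNReal.mul_lt_top ?_ hC
    have : Integrable (fun y : VV d => 2 ^ (d + 1) * wt y) := integrable_wt.const_mul _
    exact this.lintegral_lt_top
  have main : ∀ t : VV d, v1 * ∫⁻ x, ENNReal.ofReal (wt (t - x)) ∂μ ≤ K := by
    intro t
    set S : Set (VV d × VV d) := {p | ‖p.2 - p.1‖ < 1} with hS
    have hSm : MeasurableSet S :=
      (isOpen_lt (by fun_prop) continuous_const).measurableSet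
    set G : VV d × VV d → ℝ≥0∞ := S.indicator
      (fun p => ENNReal.ofReal (2 ^ (d + 1) * wt (t - p.2))) with hG
    have hGm : Measurable G := by
      refine Measurable.indicator ?_ hSm
      exact (Continuous.measurable (by fun_prop)).ennreal_ofReal
    rw [← lintegral_const_mul' _ _ hv1top]
    calc ∫⁻ x, v1 * ENNReal.ofReal (wt (t - x)) ∂μ
        ≤ ∫⁻ x, (∫⁻ y, G (x, y)) ∂μ := by
          refine lintegral_mono fun x => ?_
          have h1 : ∫⁻ y in ball x 1, ENNReal.ofReal (wt (t - x)) ≤ ∫⁻ y, G (x, y) := by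
            rw [← lintegral_indicator measurableSet_ball]
            refine lintegral_mono fun y => ?_
            by_cases hy : y ∈ ball x 1
            · have hy' : ‖y - x‖ < 1 := by simpa [dist_eq_norm] using hy
              have : (x, y) ∈ S := hy'
              simp only [hG, Set.indicator_of_mem hy, Set.indicator_of_mem this]
              exact ENNReal.ofReal_le_ofReal (wt_le hy')
            · simp [hy]
          refine le_trans (le_of_eq ?_) h1
          rw [setLIntegral_const, Measure.addHaar_ball_center, mul_comm]
      _ = ∫⁻ y, (∫⁻ x, G (x, y) ∂μ) :=
          lintegral_lintegral_swap (f := fun x y => G (x, y)) hGm.aemeasurable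
      _ ≤ ∫⁻ y, ENNReal.ofReal (2 ^ (d + 1) * wt (t - y)) * Cμ := by
          refine lintegral_mono fun y => ?_
          have : ∀ x, G (x, y) = (ball y 1).indicator
              (fun _ => ENNReal.ofReal (2 ^ (d + 1) * wt (t - y))) x := by
            intro x
            by_cases hx : ‖y - x‖ < 1
            · have h1 : (x, y) ∈ S := hx
              have h2 : x ∈ ball y 1 := by rw [mem_ball, dist_comm, dist_eq_norm]; exact hx
              simp only [hG, Set.indicator_of_mem h1, Set.indicator_of_mem h2]
            · have h1 : (x, y) ∉ S := hx
              have h2 : x ∉ ball y 1 := by rw [mem_ball, dist_comm, dist_eq_norm]; exact hx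
              simp only [hG, Set.indicator_of_notMem h1, Set.indicator_of_notMem h2]
          simp_rw [this]
          rw [lintegral_indicator_const measurableSet_ball]
          gcongr
          exact hball y
      _ = K := by
          rw [lintegral_mul_const' _ _ hC.ne, hK]
          congr 1
          exact lintegral_sub_left_eq_self (fun y => ENNReal.ofReal (2 ^ (d + 1) * wt y)) t
  have main2 : ∀ t : VV d, ∫⁻ x, ENNReal.ofReal (wt (t - x)) ∂μ ≤ K / v1 := by
    intro t
    rw [ENNReal.le_div_iff_mul_le (Or.inl hv1pos) (Or.inl hv1top), mul_comm]
    exact main t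
  have hKv : K / v1 < ⊤ := ENNReal.div_lt_top hKtop.ne hv1pos
  refine ⟨(K / v1).toReal + 1, by positivity, fun t => ?_⟩
  have hm : AEStronglyMeasurable (fun x => wt (t - x)) μ :=
    Continuous.aestronglyMeasurable (by fun_prop)
  have hnn : 0 ≤ᵐ[μ] fun x => wt (t - x) := Eventually.of_forall fun x => (wt_pos _).le
  constructor
  · refine ⟨hm, ?_⟩
    rw [hasFiniteIntegral_iff_ofReal hnn]
    exact (main2 t).trans_lt hKv
  · rw [integral_eq_lintegral_of_nonneg_ae hnn hm]
    have := ENNReal.toReal_mono hKv.ne (main2 t)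
    linarith

lemma cutoff {H : VV d → ℂ} (hH : Continuous H) {A : ℝ}
    (hA : ∀ y, ‖H y‖ * (1 + ‖y‖) ^ (d + 2) ≤ A) {ε : ℝ} (hε : 0 < ε) :
    ∃ H' : VV d → ℂ, Continuous H' ∧ HasCompactSupport H' ∧ ∀ y, ‖H y - H' y‖ ≤ ε * wt y := by
  obtain ⟨n, hn⟩ := exists_nat_ge (A / ε)
  rw [div_le_iff₀ hε] at hn
  let b : ContDiffBump (0 : VV d) := ⟨n + 1, n + 2, by positivity, by linarith⟩
  refine ⟨fun y => (b y : ℂ) * H y, ?_, ?_, fun y => ?_⟩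
  · have := b.continuous; fun_prop
  · exact (b.hasCompactSupport.comp_left (g := fun x : ℝ => (x : ℂ)) (by simp)).mul_right
  · by_cases hy : ‖y‖ ≤ n + 1
    · have : b y = 1 := b.one_of_mem_closedBall (by simpa using hy)
      simp only [this]; simp; exact mul_nonneg hε.le (wt_pos y).le
    · push Not at hy
      have e : H y - (b y : ℂ) * H y = ((1 - b y : ℝ) : ℂ) * H y := by push_cast; ring
      rw [e, norm_mul, Complex.norm_real, Real.norm_of_nonneg (by linarith [b.le_one (x := y)])]
      have h1 : (1 - b y) * ‖H y‖ ≤ ‖H y‖ := by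
        have := b.nonneg (x := y)
        nlinarith [norm_nonneg (H y)]
      refine h1.trans ?_
      unfold wt
      rw [← div_eq_mul_inv, le_div_iff₀ (by positivity)]
      have h2 := hA y
      rw [pow_succ (1 + ‖y‖) (d + 1), ← mul_assoc] at h2
      have h3 : A ≤ ε * (1 + ‖y‖) := by nlinarith
      exact le_of_mul_le_mul_right (h2.trans h3) (by positivity)

lemma sub_ball_le' {μ : Measure (VV d)} [IsLocallyFiniteMeasure μ] {u : VV d → ℂ}
    (hu : Continuous u) {C : ℝ} (hC : ∀ t, ‖u t‖ ≤ C)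
    {r R : ℝ} (hrR : r ≤ R) :
    ‖(∫ t in ball (0 : VV d) R, u t ∂μ) - ∫ t in ball (0 : VV d) r, u t ∂μ‖
      ≤ C * ((μ (ball 0 R)).toReal - (μ (ball 0 r)).toReal) := by
  have hB' : μ (ball (0 : VV d) R) < ⊤ := measure_ball_lt_top
  have hAB := ball_subset_ball (x := (0 : VV d)) hrR
  have hi : IntegrableOn u (ball (0 : VV d) R) μ :=
    Measure.integrableOn_of_bounded (M := C) hB'.ne hu.aestronglyMeasurable
      (Eventually.of_forall hC)
  rw [← setIntegral_sdiff measurableSet_ball hi hAB]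
  have h2 := norm_setIntegral_le_of_norm_le_const (μ := μ)
    (s := ball (0 : VV d) R \ ball 0 r) (f := u) (C := C)
    ((measure_mono Set.sdiff_subset).trans_lt hB') (fun t _ => hC t)
  refine h2.trans (le_of_eq ?_)
  rw [measureReal_sdiff hAB measurableSet_ball hB'.ne]
  rfl

lemma annulus_tendsto {μ : Measure (VV d)} {a : ℂ}
    (h : IsFourierBohrCoeff μ 0 a) (A : ℝ) (hA : 0 < A) :
    Tendsto (fun R => (bv d R)⁻¹ * ((μ (ball 0 (R + A))).toReal - (μ (ball 0 (R - A))).toReal))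
      atTop (𝓝 0) := by
  have h1 : Tendsto (fun R => (bv d R)⁻¹ * (μ (ball (0 : VV d) R)).toReal) atTop (𝓝 ‖a‖) := by
    have := h.norm
    refine this.congr fun R => ?_
    simp [bv, Measure.real]
  have hratio : ∀ B : ℝ, Tendsto (fun R => (bv d R)⁻¹ * bv d (R + B)) atTop (𝓝 1) := by
    intro B
    have := (bet_tendsto (d := d) B).add_const 1
    rw [zero_add] at this
    refine this.congr' ?_
    filter_upwards [eventually_gt_atTop 0, eventually_gt_atTop (-B)] with R hR hR'
    have h1 := bv_pos (d := d) one_pos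
    rw [bv_eq hR, bv_eq (by linarith : 0 < R + B), bet, div_pow]
    field_simp
    ring
  have h2 : ∀ B : ℝ, Tendsto (fun R => (bv d R)⁻¹ * (μ (ball (0 : VV d) (R + B))).toReal) atTop
      (𝓝 ‖a‖) := by
    intro B
    have := (hratio B).mul (h1.comp (tendsto_atTop_add_const_right _ B tendsto_id))
    rw [one_mul] at this
    refine this.congr' ?_
    filter_upwards [eventually_gt_atTop (-B)] with R hR'
    have h1 := bv_pos (d := d) (by linarith : 0 < R + B)
    simp only [Function.comp, id]
    field_simp
  have := (h2 A).sub (h2 (-A))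
  rw [sub_self] at this
  refine this.congr fun R => ?_
  rw [← sub_eq_add_neg]; ring

lemma coeff_cc (μ : Measure (VV d)) [μ.Regular]
    (c : VV d → ℂ) (hc : ∀ χ, IsFourierBohrCoeff μ χ (c χ))
    {H : VV d → ℂ} (hH : Continuous H) (hHc : HasCompactSupport H) (χ : VV d) :
    Tendsto (fun R => Mn R 0 (fun t => (∫ x, H (t - x) ∂μ) * ec (-χ) t)) atTop
      (𝓝 (c χ * ∫ y, H y * ec (-χ) y)) := by
  obtain ⟨A', hA'⟩ := hHc.isCompact.isBounded.subset_ball (0 : VV d)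
  set A := max A' 1 with hAdef
  have hA0 : 0 < A := by positivity
  have hHz : ∀ y, A ≤ ‖y‖ → H y = 0 := by
    intro y hy
    by_contra hne
    have := hA' (subset_tsupport H hne)
    rw [mem_ball_zero_iff] at this
    linarith [le_max_left A' 1]
  have hHi : Integrable H := hH.integrable_of_hasCompactSupport hHc
  obtain ⟨B, hB⟩ := hHc.exists_bound_of_continuous hH
  set N := ∫ y, ‖H y‖ with hN
  set Ĥ := ∫ y, H y * ec (-χ) y with hĤ
  set Ψ : VV d → ℂ := fun x => ∫ t, H (t - x) * ec (-χ) t with hΨ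
  have hΨe : ∀ x, Ψ x = ec (-χ) x * Ĥ := by
    intro x
    rw [hΨ, hĤ, ← integral_const_mul]
    simp only []
    rw [← integral_add_right_eq_self _ x]
    refine integral_congr_ae (Eventually.of_forall fun y => ?_)
    simp only [add_sub_cancel_right, ec_add]; ring
  have hΨc : Continuous Ψ := by
    have : Ψ = fun x => ec (-χ) x * Ĥ := funext hΨe
    rw [this]; fun_prop
  have hshiftN : ∀ x, ∫ t, ‖H (t - x) * ec (-χ) t‖ = N := by
    intro x
    simp only [norm_mul, norm_ec, mul_one]
    exact integral_sub_right_eq_self (fun y => ‖H y‖) x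
  have hshifti : ∀ x, Integrable (fun t => H (t - x) * ec (-χ) t) := by
    intro x
    refine (hHi.comp_sub_right x).mul_bdd (c := 1) (continuous_ec _).aestronglyMeasurable
      (Eventually.of_forall fun y => by rw [norm_ec])
  have hΨb : ∀ x, ‖Ψ x‖ ≤ N := by
    intro x
    rw [← hshiftN x]
    exact norm_integral_le_integral_norm _
  set Φ : ℝ → VV d → ℂ := fun R x => ∫ t in ball (0 : VV d) R, H (t - x) * ec (-χ) t with hΦ
  have hΦb : ∀ R x, ‖Φ R x‖ ≤ N := by
    intro R x
    rw [← hshiftN x]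
    refine (norm_integral_le_integral_norm _).trans ?_
    exact setIntegral_le_integral (hshifti x).norm (Eventually.of_forall fun t => norm_nonneg _)
  have hfin : ∀ R : ℝ, IsFiniteMeasure (volume.restrict (ball (0:VV d) R)) :=
    fun R => ⟨by simpa using measure_ball_lt_top⟩
  have hfinμ : ∀ R : ℝ, IsFiniteMeasure (μ.restrict (ball (0:VV d) R)) :=
    fun R => ⟨by simpa using measure_ball_lt_top⟩
  have hΦc : ∀ R, Continuous (Φ R) := by
    intro R
    have := hfin R
    refine continuous_of_dominated (bound := fun _ => B) ?_ ?_ ?_ ?_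
    · intro x; exact Continuous.aestronglyMeasurable (by fun_prop)
    · intro x; exact Eventually.of_forall fun t => by
        rw [norm_mul, norm_ec, mul_one]; exact hB _
    · exact integrable_const _
    · exact Eventually.of_forall fun t => by fun_prop
  have step1 : ∀ R, ∫ t in ball (0 : VV d) R, (∫ x, H (t - x) ∂μ) * ec (-χ) t =
      ∫ x in ball (0 : VV d) (R + A), Φ R x ∂μ := by
    intro R
    have := hfin R
    have := hfinμ (R + A)
    have e : ∀ t ∈ ball (0 : VV d) R, (∫ x, H (t - x) ∂μ) * ec (-χ) t =
        ∫ x in ball (0 : VV d) (R + A), H (t - x) * ec (-χ) t ∂μ := by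
      intro t ht
      rw [integral_mul_const, setIntegral_eq_integral_of_forall_compl_eq_zero]
      intro x hx
      apply hHz
      rw [mem_ball_zero_iff] at ht hx
      have := norm_sub_norm_le x t
      rw [norm_sub_rev] at this
      linarith
    rw [setIntegral_congr_fun measurableSet_ball e]
    rw [integral_integral_swap]
    refine Integrable.of_bound (C := B) ?_ (Eventually.of_forall fun p => ?_)
    · refine Continuous.aestronglyMeasurable ?_
      have h1 : Continuous (fun p : VV d × VV d => H (p.1 - p.2) * ec (-χ) p.1) :=
        (hH.comp (by fun_prop)).mul ((continuous_ec _).comp continuous_fst)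
      exact h1
    · simp only [Function.uncurry, norm_mul, norm_ec, mul_one]; exact hB _
  have step2 : ∀ R, ∀ x ∈ ball (0 : VV d) (R - A), Φ R x = Ψ x := by
    intro R x hx
    rw [hΦ, hΨ]
    refine setIntegral_eq_integral_of_forall_compl_eq_zero fun t ht => ?_
    rw [hHz, zero_mul]
    rw [mem_ball_zero_iff] at ht hx
    have := norm_sub_norm_le t x
    linarith
  have hbound : ∀ R, ‖(∫ t in ball (0 : VV d) R, (∫ x, H (t - x) ∂μ) * ec (-χ) t)
      - (∫ x in ball (0 : VV d) R, ec (-χ) x ∂μ) * Ĥ‖ ≤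
      2 * N * ((μ (ball 0 (R + A))).toReal - (μ (ball 0 (R - A))).toReal) := by
    intro R
    have e1 : (∫ x in ball (0 : VV d) R, ec (-χ) x ∂μ) * Ĥ = ∫ x in ball (0 : VV d) R, Ψ x ∂μ := by
      rw [← integral_mul_const]; simp_rw [hΨe]
    rw [e1, step1]
    have h1 := sub_ball_le' (μ := μ) (hΦc R) (hΦb R) (by linarith : R - A ≤ R + A)
    have h2 := sub_ball_le' (μ := μ) hΨc hΨb (by linarith : R - A ≤ R)
    have h3 : (μ (ball (0 : VV d) R)).toReal ≤ (μ (ball (0 : VV d) (R + A))).toReal :=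
      ENNReal.toReal_mono measure_ball_lt_top.ne
        (measure_mono (ball_subset_ball (by linarith)))
    rw [setIntegral_congr_fun measurableSet_ball (step2 R)] at h1
    have hN0 : 0 ≤ N := (norm_nonneg _).trans (hΨb 0)
    have h4 : N * ((μ (ball (0 : VV d) R)).toReal - (μ (ball (0 : VV d) (R - A))).toReal)
      ≤ N * ((μ (ball (0 : VV d) (R + A))).toReal - (μ (ball (0 : VV d) (R - A))).toReal) := by
      gcongr
    set X := ∫ x in ball (0 : VV d) (R + A), Φ R x ∂μ
    set Y := ∫ x in ball (0 : VV d) R, Ψ x ∂μ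
    set Z := ∫ x in ball (0 : VV d) (R - A), Ψ x ∂μ
    have : X - Y = (X - Z) - (Y - Z) := by ring
    rw [this]
    refine (norm_sub_le _ _).trans (by linarith)
  have hcχ : Tendsto (fun R => ((bv d R)⁻¹ • ∫ x in ball (0 : VV d) R, ec (-χ) x ∂μ) * Ĥ) atTop
      (𝓝 (c χ * Ĥ)) := by
    refine Tendsto.mul_const _ ?_
    refine (hc χ).congr fun R => ?_
    simp only [bv]
    congr 1
    refine integral_congr_ae (Eventually.of_forall fun t => ?_)
    simp only [ec, inner_neg_left, mul_neg]
  have hdiff : Tendsto (fun R => Mn R 0 (fun t => (∫ x, H (t - x) ∂μ) * ec (-χ) t) -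
      ((bv d R)⁻¹ • ∫ x in ball (0 : VV d) R, ec (-χ) x ∂μ) * Ĥ) atTop (𝓝 0) := by
    have h1 := (annulus_tendsto (hc 0) A hA0).const_mul (2 * N)
    rw [mul_zero] at h1
    refine squeeze_zero_norm' ?_ h1
    filter_upwards [eventually_gt_atTop 0] with R hR
    have hv := bv_pos (d := d) hR
    unfold Mn
    simp only [zero_add]
    rw [smul_mul_assoc, ← smul_sub, norm_smul, norm_inv, Real.norm_of_nonneg hv.le]
    have := hbound R
    calc _ ≤ (bv d R)⁻¹ * (2 * N * ((μ (ball 0 (R + A))).toReal - (μ (ball 0 (R - A))).toReal)) := by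
          gcongr
      _ = _ := by ring
  have := hdiff.add hcχ
  rw [zero_add] at this
  refine this.congr fun R => by ring
end meas

section series
variable {d : ℕ}

lemma mean_lim {u : VV d → ℂ} (hu : Continuous u) {C : ℝ} (hC : ∀ t, ‖u t‖ ≤ C) {a : ℂ}
    (h : ∀ ε > 0, ∃ (u' : VV d → ℂ) (C' : ℝ) (a' : ℂ), Continuous u' ∧ (∀ t, ‖u' t‖ ≤ C') ∧
      (∀ t, ‖u t - u' t‖ ≤ ε) ∧ Tendsto (fun R => Mn R 0 u') atTop (𝓝 a') ∧ ‖a - a'‖ ≤ ε) :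
    Tendsto (fun R => Mn R 0 u) atTop (𝓝 a) := by
  rw [Metric.tendsto_nhds]
  intro ε hε
  obtain ⟨u', C', a', hu', hC', h1, h2, h3⟩ := h (ε / 4) (by positivity)
  rw [Metric.tendsto_nhds] at h2
  filter_upwards [h2 (ε / 4) (by positivity), eventually_gt_atTop 0] with R hR hR0
  have h4 : ‖Mn R 0 (fun t => u t - u' t)‖ ≤ ε / 4 := Mn_norm_le h1 hR0 0
  rw [Mn_sub hu hu' hC hC'] at h4
  rw [dist_eq_norm] at hR ⊢
  have e : Mn R 0 u - a = (Mn R 0 u - Mn R 0 u') + (Mn R 0 u' - a') - (a - a') := by ring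
  rw [e]
  have := norm_sub_le ((Mn R 0 u - Mn R 0 u') + (Mn R 0 u' - a')) (a - a')
  have := norm_add_le (Mn R 0 u - Mn R 0 u') (Mn R 0 u' - a')
  linarith

lemma Mn_shift_lim {u : VV d → ℂ} (hu : Continuous u) {C : ℝ} (hC : ∀ t, ‖u t‖ ≤ C) {a : ℂ}
    (h : Tendsto (fun R => Mn R 0 u) atTop (𝓝 a)) (y : VV d) :
    Tendsto (fun R => Mn R y u) atTop (𝓝 a) := by
  have h1 : Tendsto (fun R => Mn R y u - Mn R 0 u) atTop (𝓝 0) := by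
    have h2 := (bet_tendsto (d := d) ‖y‖).const_mul (2 * C)
    rw [mul_zero] at h2
    refine squeeze_zero_norm' ?_ h2
    filter_upwards [eventually_gt_atTop 0] with R hR
    exact Mn_bdry hu hC hR y
  have := h1.add h
  rw [zero_add] at this
  exact this.congr fun R => by ring

lemma char_mean_zero {ψ : VV d} (hψ : ψ ≠ 0) :
    Tendsto (fun R => Mn R 0 (ec ψ)) atTop (𝓝 0) := by
  set s : VV d := (1 / (2 * ‖ψ‖ ^ 2)) • ψ with hs
  have hn : ‖ψ‖ ≠ 0 := norm_ne_zero_iff.2 hψ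
  have hes : ec ψ s = -1 := by
    simp only [ec, hs, inner_smul_right, real_inner_self_eq_norm_sq]
    have : 2 * Real.pi * (1 / (2 * ‖ψ‖ ^ 2) * ‖ψ‖ ^ 2) = Real.pi := by field_simp
    rw [this, Complex.exp_pi_mul_I]
  have h2 := (bet_tendsto (d := d) ‖s‖).const_mul (2 * 1)
  rw [mul_zero] at h2
  refine squeeze_zero_norm' ?_ h2
  filter_upwards [eventually_gt_atTop 0] with R hR
  have h1 := Mn_bdry (continuous_ec ψ) (C := 1) (fun t => (norm_ec ψ t).le) hR s
  have e : Mn R s (ec ψ) = - Mn R 0 (ec ψ) := by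
    have := Mn_shift (ec ψ) R 0 s
    rw [add_zero] at this
    rw [← this]
    simp_rw [ec_add, hes]
    rw [Mn_mul]; simp
  rw [e] at h1
  have e2 : - Mn R 0 (ec ψ) - Mn R 0 (ec ψ) = (-2) * Mn R 0 (ec ψ) := by ring
  rw [e2, norm_mul] at h1
  simp only [norm_neg, Complex.norm_ofNat] at h1
  have := norm_nonneg (Mn R 0 (ec ψ))
  linarith

lemma ap_coeff {F : VV d → ℂ} (hF : Continuous F) {C : ℝ} (hC : ∀ t, ‖F t‖ ≤ C)
    {χ : VV d} {a : ℂ}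
    (ha : Tendsto (fun R => Mn R 0 (fun t => F t * ec (-χ) t)) atTop (𝓝 a))
    {s : VV d} {ε : ℝ} (hs : ∀ t, ‖F (t + s) - F t‖ ≤ ε) : ‖a * (ec χ s - 1)‖ ≤ ε := by
  have hu : Continuous (fun t => F t * ec (-χ) t) := by fun_prop
  have hub : ∀ t, ‖F t * ec (-χ) t‖ ≤ C := fun t => by rw [norm_mul, norm_ec, mul_one]; exact hC t
  have h1 := (Mn_shift_lim hu hub ha s).const_mul (ec χ s)
  have h2 : ∀ R, ec χ s * Mn R s (fun t => F t * ec (-χ) t) =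
      Mn R 0 (fun t => F (s + t) * ec (-χ) t) := by
    intro R
    have := Mn_shift (fun t => F t * ec (-χ) t) R 0 s
    rw [add_zero] at this
    rw [← this, ← Mn_mul]
    congr 1
    ext t
    rw [ec_add]
    have : ec χ s * ec (-χ) s = 1 := by rw [mul_comm]; exact ec_neg_mul χ s
    linear_combination (F (s + t) * ec (-χ) t) * this
  simp_rw [h2] at h1
  have h3 := (h1.sub ha).norm
  have e : ec χ s * a - a = a * (ec χ s - 1) := by ring
  rw [e] at h3
  refine le_of_tendsto h3 ?_
  filter_upwards [eventually_gt_atTop 0] with R hR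
  rw [← Mn_sub (C := C) (C' := C) (by fun_prop) hu _ hub]
  · refine Mn_norm_le (fun t => ?_) hR 0
    rw [← sub_mul, norm_mul, norm_ec, mul_one, add_comm]
    exact hs t
  · intro t; rw [norm_mul, norm_ec, mul_one]; exact hC _

lemma ap_series {F : VV d → ℂ} (hF : Continuous F) (hap : APer F) {C : ℝ} (hC : ∀ t, ‖F t‖ ≤ C)
    {a : VV d → ℂ}
    (ha : ∀ χ, Tendsto (fun R => Mn R 0 (fun t => F t * ec (-χ) t)) atTop (𝓝 (a χ)))
    (hs : Summable fun χ => ‖a χ‖) : F 0 = ∑' χ, a χ := by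
  set G : VV d → ℂ := fun t => ∑' χ, a χ * ec χ t with hG
  have hnorm : ∀ χ t, ‖a χ * ec χ t‖ = ‖a χ‖ := fun χ t => by rw [norm_mul, norm_ec, mul_one]
  have hsum : ∀ t, Summable fun χ => a χ * ec χ t := fun t =>
    Summable.of_norm (by simpa only [hnorm] using hs)
  have hGc : Continuous G := by
    refine continuous_tsum (u := fun χ => ‖a χ‖) (fun χ => by fun_prop) hs fun χ t => (hnorm χ t).le
  have hGb : ∀ t, ‖G t‖ ≤ ∑' χ, ‖a χ‖ := by
    intro t
    refine (norm_tsum_le_tsum_norm (by simpa only [hnorm] using hs)).trans ?_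
    simp only [hnorm]; exact le_rfl
  have hDb : ∀ t, ‖F t - G t‖ ≤ C + ∑' χ, ‖a χ‖ := fun t =>
    (norm_sub_le _ _).trans (add_le_add (hC t) (hGb t))
  have hunif := tendstoUniformly_tsum (f := fun χ t => a χ * ec χ t) hs (fun χ t => (hnorm χ t).le)
  have hminS : ∀ δ : ℝ, 0 ≤ δ → Summable fun χ => min (2 * ‖a χ‖) δ := fun δ hδ =>
    Summable.of_nonneg_of_le (fun χ => le_min (by positivity) hδ) (fun χ => min_le_left _ _)
      (hs.mul_left 2)
  have hGap : ∀ s δ, 0 ≤ δ → (∀ t, ‖F (t + s) - F t‖ ≤ δ) →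
      ∀ t, ‖G (t + s) - G t‖ ≤ ∑' χ, min (2 * ‖a χ‖) δ := by
    intro s δ hδ h t
    rw [hG]
    simp only
    rw [← (hsum (t + s)).tsum_sub (hsum t)]
    refine tsum_of_norm_bounded (hminS δ hδ).hasSum fun χ => ?_
    have e : a χ * ec χ (t + s) - a χ * ec χ t = (a χ * (ec χ s - 1)) * ec χ t := by
      rw [ec_add]; ring
    refine le_min ?_ ?_
    · refine (norm_sub_le _ _).trans ?_
      rw [hnorm, hnorm]; linarith
    · rw [e, norm_mul, norm_ec, mul_one]
      exact ap_coeff hF hC (ha χ) h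
  have hphi : Tendsto (fun δ : ℝ => ∑' χ, min (2 * ‖a χ‖) δ) (𝓝[>] 0) (𝓝 0) := by
    have key : Tendsto (fun δ : ℝ => ∑' χ, min (2 * ‖a χ‖) δ) (𝓝[>] 0)
        (𝓝 (∑' _ : VV d, (0 : ℝ))) := by
      refine tendsto_tsum_of_dominated_convergence (bound := fun χ => 2 * ‖a χ‖)
        (hs.mul_left 2) ?_ ?_
      · intro χ
        have h1 : Tendsto (fun δ : ℝ => min (2 * ‖a χ‖) δ) (𝓝[>] 0) (𝓝 (min (2 * ‖a χ‖) 0)) :=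
          (tendsto_const_nhds.min tendsto_id).mono_left nhdsWithin_le_nhds
        rwa [min_eq_right (by positivity)] at h1
      · filter_upwards [self_mem_nhdsWithin] with δ hδ χ
        rw [Real.norm_of_nonneg (le_min (by positivity) (le_of_lt hδ))]
        exact min_le_left _ _
    simpa using key
  have hDap : APer (fun t => F t - G t) := by
    intro ε hε
    have h1 := hphi.eventually (gt_mem_nhds (half_pos hε))
    have h2 : ∀ᶠ δ in 𝓝[>] (0:ℝ), δ < ε / 2 :=
      nhdsWithin_le_nhds (gt_mem_nhds (half_pos hε))
    obtain ⟨δ, ⟨h1, h2⟩, h3⟩ := ((h1.and h2).and self_mem_nhdsWithin).exists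
    have h3 : 0 < δ := h3
    obtain ⟨L, hL, hLp⟩ := hap δ h3
    refine ⟨L, hL, fun x => ?_⟩
    obtain ⟨s, hs1, hs2⟩ := hLp x
    refine ⟨s, hs1, fun t => ?_⟩
    have h4 := hGap s δ h3.le hs2 t
    have h5 := hs2 t
    have e : F (t + s) - G (t + s) - (F t - G t) = (F (t + s) - F t) - (G (t + s) - G t) := by ring
    rw [e]
    refine (norm_sub_le _ _).trans (by linarith)
  have hGmean : ∀ ψ, Tendsto (fun R => Mn R 0 (fun t => G t * ec (-ψ) t)) atTop (𝓝 (a ψ)) := by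
    intro ψ
    refine mean_lim (C := ∑' χ, ‖a χ‖) (by fun_prop) (fun t => ?_) ?_
    · rw [norm_mul, norm_ec, mul_one]; exact hGb t
    intro ε hε
    rw [Metric.tendstoUniformly_iff] at hunif
    obtain ⟨S, hS1, hS2⟩ := ((hunif ε hε).and (eventually_ge_atTop {ψ})).exists
    have hψS : ψ ∈ S := hS2 (Finset.mem_singleton_self ψ)
    refine ⟨fun t => (∑ χ ∈ S, a χ * ec χ t) * ec (-ψ) t, ∑ χ ∈ S, ‖a χ‖, a ψ, by fun_prop,
      fun t => ?_, fun t => ?_, ?_, by simpa using hε.le⟩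
    · rw [norm_mul, norm_ec, mul_one]
      refine (norm_sum_le _ _).trans (Finset.sum_le_sum fun χ _ => (hnorm χ t).le)
    · rw [← sub_mul, norm_mul, norm_ec, mul_one]
      have := hS1 t
      rw [dist_eq_norm] at this
      exact this.le
    · have e : ∀ R, Mn R 0 (fun t => (∑ χ ∈ S, a χ * ec χ t) * ec (-ψ) t) =
          ∑ χ ∈ S, a χ * Mn R 0 (ec (χ - ψ)) := by
        intro R
        simp_rw [← Mn_mul]
        unfold Mn
        rw [← Finset.smul_sum, ← integral_finset_sum]
        · congr 1
          refine integral_congr_ae (Eventually.of_forall fun t => ?_)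
          simp only [Finset.sum_mul, mul_assoc, sub_eq_add_neg, ec_add_left]
        · intro χ _
          exact integrableOn_of_bdd (C := ‖a χ‖) (by fun_prop)
            (fun t => by rw [norm_mul, norm_ec, mul_one]) measure_ball_lt_top
      simp_rw [e]
      have e2 : a ψ = ∑ χ ∈ S, a χ * (if χ = ψ then 1 else 0) := by simp [hψS]
      rw [e2]
      refine tendsto_finset_sum _ fun χ _ => Tendsto.const_mul _ ?_
      split_ifs with h
      · subst h
        refine tendsto_const_nhds.congr' ?_
        filter_upwards [eventually_gt_atTop 0] with R hR
        have : (ec (χ - χ) : VV d → ℂ) = fun _ => 1 := by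
          ext t; simp [ec]
        rw [this, Mn_const hR]
      · exact char_mean_zero (sub_ne_zero.2 h)
  have h0 := ap_uniq (D := fun t => F t - G t) (by fun_prop) hDap hDb ?_
  · have h1 : F 0 = G 0 := sub_eq_zero.1 h0
    rw [h1, hG]
    simp [ec]
  · intro χ
    have h1 := (ha (-χ)).sub (hGmean (-χ))
    rw [sub_self] at h1
    refine h1.congr fun R => ?_
    rw [neg_neg]
    rw [← Mn_sub (C := C) (C' := ∑' χ, ‖a χ‖) (by fun_prop) (by fun_prop)]
    · simp only [sub_mul]
    · intro t; rw [norm_mul, norm_ec, mul_one]; exact hC t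
    · intro t; rw [norm_mul, norm_ec, mul_one]; exact hGb t
end series

section poisson
variable {d : ℕ}

lemma APer_of_bohr {F : VV d → ℂ} (h : IsBohrAlmostPeriodic F) : APer F := by
  intro ε hε
  obtain ⟨S, hS⟩ := h.2.2 ε hε
  refine ⟨∑ s ∈ S, ‖s‖ + 1, by positivity, fun x => ?_⟩
  obtain ⟨s₀, hs₀, h1⟩ := hS x
  refine ⟨x - s₀, ?_, fun t => ?_⟩
  · have e : x - s₀ - x = - s₀ := by abel
    rw [e, norm_neg]
    have := Finset.single_le_sum (f := fun s : VV d => ‖s‖) (fun s _ => norm_nonneg s) hs₀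
    linarith
  · have := h1 (t + x)
    rw [norm_sub_rev] at this
    rw [add_sub_cancel_right] at this
    rwa [← add_sub_assoc]

lemma poisson (μ : Measure (VV d)) [μ.Regular]
    (hTB : ∀ K : Set (VV d), IsCompact K → (⨆ x : VV d, μ (x +ᵥ K)) < ⊤)
    (hSAP : ∀ f : VV d → ℂ, Continuous f → HasCompactSupport f →
      IsBohrAlmostPeriodic fun t => ∫ x, f (t - x) ∂μ)
    (c : VV d → ℂ) (hc : ∀ χ, IsFourierBohrCoeff μ χ (c χ))
    {H : VV d → ℂ} (hH : Continuous H) {A : ℝ}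
    (hA : ∀ y, ‖H y‖ * (1 + ‖y‖) ^ (d + 2) ≤ A)
    (hs : Summable fun χ => ‖c χ * ∫ y, H y * ec (-χ) y‖) :
    Integrable (fun x => H (-x)) μ ∧
    ∫ x, H (-x) ∂μ = ∑' χ, c χ * ∫ y, H y * ec (-χ) y := by
  obtain ⟨T, hT0, hT⟩ := wt_bound μ hTB
  have hA0 : 0 ≤ A := le_trans (by positivity) (hA 0)
  have hHw : ∀ y, ‖H y‖ ≤ A * wt y := by
    intro y
    unfold wt
    rw [← div_eq_mul_inv, le_div_iff₀ (by positivity)]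
    refine le_trans ?_ (hA y)
    gcongr
    · linarith [norm_nonneg y]
    · omega
  -- generic estimate
  have gen : ∀ (P : VV d → ℂ) (e : ℝ), Continuous P → (∀ y, ‖P y‖ ≤ e * wt y) → ∀ t,
      Integrable (fun x => P (t - x)) μ ∧ ‖∫ x, P (t - x) ∂μ‖ ≤ e * ∫ x, wt (t - x) ∂μ := by
    intro P e hP hPe t
    have hi := (hT t).1.const_mul e
    refine ⟨hi.mono' (Continuous.aestronglyMeasurable (by fun_prop))
      (Eventually.of_forall fun x => hPe _), ?_⟩
    rw [← integral_const_mul]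
    exact norm_integral_le_of_norm_le hi (Eventually.of_forall fun x => hPe _)
  have genv : ∀ (P : VV d → ℂ) (e : ℝ), Continuous P → (∀ y, ‖P y‖ ≤ e * wt y) → ∀ χ,
      Integrable (fun y => P y * ec (-χ) y) ∧
      ‖∫ y, P y * ec (-χ) y‖ ≤ e * ∫ y : VV d, wt y := by
    intro P e hP hPe χ
    have hi := (integrable_wt (d := d)).const_mul e
    have hb : ∀ y, ‖P y * ec (-χ) y‖ ≤ e * wt y := fun y => by
      rw [norm_mul, norm_ec, mul_one]; exact hPe y
    refine ⟨hi.mono' (Continuous.aestronglyMeasurable (by fun_prop))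
      (Eventually.of_forall hb), ?_⟩
    rw [← integral_const_mul]
    exact norm_integral_le_of_norm_le hi (Eventually.of_forall hb)
  set F : VV d → ℂ := fun t => ∫ x, H (t - x) ∂μ with hF
  set W := ∫ y : VV d, wt y with hW
  have hW0 : 0 ≤ W := integral_nonneg fun y => (wt_pos y).le
  have appr : ∀ ε > 0, ∃ H' : VV d → ℂ, Continuous H' ∧ HasCompactSupport H' ∧
      (∀ t, ‖F t - ∫ x, H' (t - x) ∂μ‖ ≤ ε) ∧
      ∀ χ, ‖(∫ y, H y * ec (-χ) y) - ∫ y, H' y * ec (-χ) y‖ ≤ ε := by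
    intro ε hε
    obtain ⟨H', hH', hHc', hb⟩ := cutoff hH hA (ε := ε / (T + W)) (by positivity)
    have hTW : 0 < T + W := by positivity
    refine ⟨H', hH', hHc', fun t => ?_, fun χ => ?_⟩
    · have h1 := gen (fun y => H y - H' y) _ (by fun_prop) hb t
      have h2 := gen H A hH hHw t
      have h3 : Integrable (fun x => H' (t - x)) μ := by
        have := h2.1.sub h1.1
        refine this.congr (Eventually.of_forall fun x => ?_)
        simp
      rw [hF]
      simp only
      rw [← integral_sub h2.1 h3]
      refine h1.2.trans ?_
      rw [div_mul_eq_mul_div, div_le_iff₀ hTW]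
      gcongr
      linarith [(hT t).2]
    · have h1 := genv (fun y => H y - H' y) _ (by fun_prop) hb χ
      have h2 := genv H A hH hHw χ
      have h3 : Integrable (fun x => H' x * ec (-χ) x) := by
        have := h2.1.sub h1.1
        refine this.congr (Eventually.of_forall fun x => ?_)
        simp only [Pi.sub_apply]; ring
      rw [← integral_sub h2.1 h3]
      simp only [sub_mul] at h1
      refine h1.2.trans ?_
      rw [div_mul_eq_mul_div, div_le_iff₀ hTW]
      gcongr
      linarith
  have hFc : Continuous F := by
    refine continuous_of_uniform_approx_of_continuous fun u hu => ?_
    obtain ⟨ε, hε, hεu⟩ := Metric.mem_uniformity_dist.1 hu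
    obtain ⟨H', hH', hHc', h1, -⟩ := appr (ε / 2) (by positivity)
    refine ⟨_, (hSAP H' hH' hHc').1, fun t => hεu ?_⟩
    rw [dist_eq_norm]
    linarith [h1 t]
  have hFb : ∀ t, ‖F t‖ ≤ A * T := by
    intro t
    refine (gen H A hH hHw t).2.trans ?_
    gcongr
    exact (hT t).2
  have hFap : APer F := by
    intro ε hε
    obtain ⟨H', hH', hHc', h1, -⟩ := appr (ε / 3) (by positivity)
    obtain ⟨L, hL, hLp⟩ := APer_of_bohr (hSAP H' hH' hHc') (ε / 3) (by positivity)
    refine ⟨L, hL, fun x => ?_⟩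
    obtain ⟨s, hs1, hs2⟩ := hLp x
    refine ⟨s, hs1, fun t => ?_⟩
    have a1 := h1 (t + s)
    have a2 := h1 t
    have a3 := hs2 t
    set F' : VV d → ℂ := fun t => ∫ x, H' (t - x) ∂μ with hF'
    change ‖F (t + s) - F' (t + s)‖ ≤ _ at a1
    change ‖F t - F' t‖ ≤ _ at a2
    change ‖F' (t + s) - F' t‖ ≤ _ at a3
    have e : F (t + s) - F t = (F (t + s) - F' (t + s)) + (F' (t + s) - F' t) - (F t - F' t) := by
      ring
    rw [e]
    have := norm_sub_le ((F (t + s) - F' (t + s)) + (F' (t + s) - F' t)) (F t - F' t)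
    have := norm_add_le (F (t + s) - F' (t + s)) (F' (t + s) - F' t)
    linarith
  have hmean : ∀ χ, Tendsto (fun R => Mn R 0 (fun t => F t * ec (-χ) t)) atTop
      (𝓝 (c χ * ∫ y, H y * ec (-χ) y)) := by
    intro χ
    refine mean_lim (C := A * T) (by fun_prop) (fun t => ?_) ?_
    · rw [norm_mul, norm_ec, mul_one]; exact hFb t
    intro ε hε
    obtain ⟨H', hH', hHc', h1, h2⟩ := appr (ε / (1 + ‖c χ‖)) (by positivity)
    have h3 := hSAP H' hH' hHc'
    obtain ⟨C', hC'⟩ := h3.2.1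
    refine ⟨fun t => (∫ x, H' (t - x) ∂μ) * ec (-χ) t, C', c χ * ∫ y, H' y * ec (-χ) y,
      h3.1.mul (continuous_ec _), fun t => ?_, fun t => ?_, coeff_cc μ c hc hH' hHc' χ, ?_⟩
    · rw [norm_mul, norm_ec, mul_one]; exact hC' t
    · rw [← sub_mul, norm_mul, norm_ec, mul_one]
      refine (h1 t).trans ?_
      exact div_le_self hε.le (by linarith [norm_nonneg (c χ)])
    · rw [← mul_sub, norm_mul]
      calc _ ≤ ‖c χ‖ * (ε / (1 + ‖c χ‖)) := by gcongr; exact h2 χ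
        _ ≤ ε := by
          rw [mul_div_assoc', div_le_iff₀ (by positivity)]
          nlinarith [norm_nonneg (c χ)]
  have h0 := (gen H A hH hHw 0).1
  simp only [zero_sub] at h0
  refine ⟨h0, ?_⟩
  have := ap_series hFc hFap hFb hmean hs
  rw [← this, hF]
  simp
end poisson

section final
variable {d : ℕ}

/-- autocorrelation -/
def acr {d : ℕ} (f : VV d → ℂ) (x : VV d) : ℂ := ∫ s, f s * (starRingEnd ℂ) (f (s + x))

lemma acr_int_bound {f : VV d → ℂ} {M r : ℝ} (hM : ∀ x, ‖f x‖ ≤ M)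
    (hr : ∀ x, r ≤ ‖x‖ → f x = 0) (x s : VV d) :
    ‖f s * (starRingEnd ℂ) (f (s + x))‖ ≤ (ball (0 : VV d) r).indicator (fun _ => M * M) s := by
  by_cases hs : s ∈ ball (0 : VV d) r
  · rw [Set.indicator_of_mem hs, norm_mul, RCLike.norm_conj]
    have h0 := (norm_nonneg _).trans (hM 0)
    exact mul_le_mul (hM _) (hM _) (norm_nonneg _) h0
  · rw [Set.indicator_of_notMem hs, hr s (by simpa using hs)]; simp

lemma integrable_ind (r K : ℝ) :
    Integrable ((ball (0 : VV d) r).indicator (fun _ => K)) := by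
  rw [integrable_indicator_iff measurableSet_ball]
  exact integrableOn_const measure_ball_lt_top.ne

lemma acr_bound {f : VV d → ℂ} {M r : ℝ} (hM : ∀ x, ‖f x‖ ≤ M)
    (hr : ∀ x, r ≤ ‖x‖ → f x = 0) (x : VV d) : ‖acr f x‖ ≤ ∫ s : VV d, (ball (0 : VV d) r).indicator (fun _ => M * M) s :=
  norm_integral_le_of_norm_le (integrable_ind _ _)
    (Eventually.of_forall fun s => acr_int_bound hM hr x s)

lemma acr_zero {f : VV d → ℂ} {r : ℝ} (hr : ∀ x, r ≤ ‖x‖ → f x = 0) {x : VV d}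
    (hx : 2 * r ≤ ‖x‖) : acr f x = 0 := by
  have : ∀ s, f s * (starRingEnd ℂ) (f (s + x)) = 0 := by
    intro s
    by_cases hs : r ≤ ‖s‖
    · rw [hr s hs, zero_mul]
    · rw [hr (s + x), map_zero, mul_zero]
      have := norm_sub_le (s + x) s
      rw [add_sub_cancel_left] at this
      linarith
  simp [acr, this]

lemma sum_loc {c : VV d → ℂ}
    (hsum : ∀ K : Set (VV d), IsCompact K → Summable fun x : K => ‖c x‖) (ρ B : ℝ) :
    Summable fun x => (closedBall (0 : VV d) ρ).indicator (fun x => ‖c x‖) x * B := by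
  refine Summable.mul_right _ ?_
  have := hsum _ (isCompact_closedBall (0 : VV d) ρ)
  exact summable_subtype_iff_indicator.1 this

lemma le_loc {c g : VV d → ℂ} {ρ B : ℝ} (hB : ∀ x, ‖g x‖ ≤ B) (hρ : ∀ x, ρ ≤ ‖x‖ → g x = 0)
    (x : VV d) : ‖c x * g x‖ ≤ (closedBall (0 : VV d) ρ).indicator (fun x => ‖c x‖) x * B := by
  by_cases hx : x ∈ closedBall (0 : VV d) ρ
  · rw [Set.indicator_of_mem hx, norm_mul]; gcongr; exact hB x
  · rw [Set.indicator_of_notMem hx, hρ x (by simp at hx; exact hx.le)]; simp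

lemma fourierInv_eq_neg (f : VV d → ℂ) (x : VV d) : 𝓕⁻ f x = 𝓕 f (-x) := by
  rw [fourierInv_eq_ec, fourier_eq_ec, neg_neg]

lemma smooth_decay {f : VV d → ℂ} (hf : ContDiff ℝ (⊤ : ℕ∞) f) (hfc : HasCompactSupport f) :
    ∃ A, ∀ y, ‖((‖𝓕 f y‖ ^ 2 : ℝ) : ℂ)‖ * (1 + ‖y‖) ^ (d + 2) ≤ A := by
  set S := 𝓕 (hfc.toSchwartzMap hf) with hS
  have hSe : ∀ y, S y = 𝓕 f y := fun y => by rw [hS, SchwartzMap.fourier_coe]; rfl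
  have h1 := fun y => SchwartzMap.one_add_le_sup_seminorm_apply (𝕜 := ℝ) (m := (d + 2, 0))
    (k := d + 2) (n := 0) le_rfl le_rfl S y
  simp only [norm_iteratedFDeriv_zero] at h1
  set A := 2 ^ (d + 2) * ((Finset.Iic (d + 2, 0)).sup fun m => SchwartzMap.seminorm ℝ m.1 m.2) S
  have hA0 : 0 ≤ A := le_trans (by positivity) (h1 0)
  refine ⟨A * A, fun y => ?_⟩
  rw [Complex.norm_real, norm_pow, norm_norm, ← hSe]
  have h2 : ‖S y‖ ≤ A := by
    refine le_trans ?_ (h1 y)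
    refine le_mul_of_one_le_left (norm_nonneg _) (one_le_pow₀ (by linarith [norm_nonneg y]))
  calc ‖S y‖ ^ 2 * (1 + ‖y‖) ^ (d + 2) = ((1 + ‖y‖) ^ (d + 2) * ‖S y‖) * ‖S y‖ := by ring
    _ ≤ A * A := mul_le_mul (h1 y) h2 (norm_nonneg _) hA0

lemma plancherel_acr {f : VV d → ℂ} (hf : ContDiff ℝ (⊤ : ℕ∞) f) (hfc : HasCompactSupport f)
    (χ : VV d) : ∫ y, ((‖𝓕 f y‖ ^ 2 : ℝ) : ℂ) * ec (-χ) y = acr f χ := by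
  set g : VV d → ℂ := fun s => f (s + χ) with hg
  have hgs : ContDiff ℝ (⊤ : ℕ∞) g := hf.comp (contDiff_id.add contDiff_const)
  have hgc : HasCompactSupport g := hfc.comp_homeomorph (Homeomorph.addRight χ)
  have h := SchwartzMap.integral_inner_fourier_fourier (hgc.toSchwartzMap hgs)
    (hfc.toSchwartzMap hf)
  have h2 : ∫ ξ, inner ℂ (𝓕 g ξ) (𝓕 f ξ) = ∫ x, inner ℂ (g x) (f x) := h
  have hfg : ∀ y, 𝓕 g y = ec y χ * 𝓕 f y := by
    intro y
    rw [fourier_eq_ec, fourier_eq_ec, ← integral_const_mul]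
    rw [← integral_sub_right_eq_self _ χ]
    refine integral_congr_ae (Eventually.of_forall fun v => ?_)
    simp only [hg, sub_add_cancel]
    rw [sub_eq_add_neg, ec_add, ← ec_neg_left, neg_neg]
    ring
  have hsymm : ∀ y, (starRingEnd ℂ) (ec y χ) = ec (-χ) y := by
    intro y
    rw [conj_ec]; simp [ec, real_inner_comm]
  rw [acr]
  calc _ = ∫ ξ, inner ℂ (𝓕 g ξ) (𝓕 f ξ) := by
        refine integral_congr_ae (Eventually.of_forall fun y => ?_)
        simp only [RCLike.inner_apply, hfg, map_mul, hsymm]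
        have : ((‖𝓕 f y‖ ^ 2 : ℝ) : ℂ) = 𝓕 f y * (starRingEnd ℂ) (𝓕 f y) := by
          rw [Complex.mul_conj, Complex.normSq_eq_norm_sq]
        rw [this]; ring
    _ = _ := by
        rw [h2]
        rfl

lemma mollify {f : VV d → ℂ} (hf : Continuous f) (hfc : HasCompactSupport f) {M r : ℝ}
    (hM : ∀ x, ‖f x‖ ≤ M) (hr : ∀ x, r ≤ ‖x‖ → f x = 0) :
    ∃ fn : ℕ → VV d → ℂ, (∀ n, ContDiff ℝ (⊤ : ℕ∞) (fn n)) ∧ (∀ n, HasCompactSupport (fn n)) ∧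
      (∀ n x, ‖fn n x‖ ≤ M) ∧ (∀ n x, r + 1 ≤ ‖x‖ → fn n x = 0) ∧
      (∀ n ξ, ‖𝓕⁻ (fn n) ξ‖ ≤ ‖𝓕⁻ f ξ‖) ∧ ∀ x, Tendsto (fun n => fn n x) atTop (𝓝 (f x)) := by
  let φ : ℕ → ContDiffBump (0 : VV d) := fun n =>
    ⟨1 / ((n : ℝ) + 1) / 2, 1 / ((n : ℝ) + 1), by positivity, half_lt_self (by positivity)⟩
  have hφ1 : ∀ n, (φ n).rOut ≤ 1 := by
    intro n
    change 1 / ((n : ℝ) + 1) ≤ 1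
    rw [div_le_one (by positivity)]
    have : (0 : ℝ) ≤ n := by positivity
    linarith
  have hφi : ∀ n, Integrable ((φ n).normed volume) := fun n => (φ n).integrable_normed
  have hfi : Integrable f := hf.integrable_of_hasCompactSupport hfc
  let fn : ℕ → VV d → ℂ := fun n =>
    convolution ((φ n).normed volume) f (ContinuousLinearMap.lsmul ℝ ℝ) volume
  have hfn : ∀ n x, fn n x = ∫ t, (φ n).normed volume t • f (x - t) := fun n x => rfl
  have hfe : ∀ n, fn n = convolution (fun x => (((φ n).normed volume x : ℝ) : ℂ)) f
      (ContinuousLinearMap.mul ℂ ℂ) volume := by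
    intro n
    ext x
    rw [hfn]
    simp only [convolution_def, ContinuousLinearMap.mul_apply', Complex.real_smul]
  refine ⟨fn, fun n => ?_, fun n => ?_, fun n x => ?_, fun n x hx => ?_, fun n ξ => ?_, fun x => ?_⟩
  · exact HasCompactSupport.contDiff_convolution_left _ (φ n).hasCompactSupport_normed
      (φ n).contDiff_normed hfi.locallyIntegrable
  · exact HasCompactSupport.convolution _ (φ n).hasCompactSupport_normed hfc
  · rw [hfn]
    have h1 : ∫ t, (φ n).normed volume t * M = M := by
      rw [integral_mul_const, (φ n).integral_normed, one_mul]
    rw [← h1]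
    refine norm_integral_le_of_norm_le ((hφi n).mul_const M) (Eventually.of_forall fun t => ?_)
    rw [norm_smul, Real.norm_of_nonneg ((φ n).nonneg_normed t)]
    exact mul_le_mul_of_nonneg_left (hM _) ((φ n).nonneg_normed t)
  · rw [hfn]
    refine integral_eq_zero_of_ae (Eventually.of_forall fun t => ?_)
    by_cases ht : t ∈ Function.support ((φ n).normed volume)
    · rw [(φ n).support_normed_eq, mem_ball_zero_iff] at ht
      have : f (x - t) = 0 := by
        apply hr
        have := norm_sub_norm_le x t
        linarith [hφ1 n]
      simp [this]
    · rw [Function.notMem_support] at ht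
      simp [ht]
  · have key : 𝓕 (convolution (fun x => (((φ n).normed volume x : ℝ) : ℂ)) f
        (ContinuousLinearMap.mul ℂ ℂ) volume) (-ξ) =
        𝓕 (fun x => (((φ n).normed volume x : ℝ) : ℂ)) (-ξ) * 𝓕 f (-ξ) :=
      Real.fourier_mul_convolution_eq (R := ℂ) (hφi n).ofReal hfi (-ξ)
    rw [fourierInv_eq_neg, fourierInv_eq_neg, hfe n, key, norm_mul]
    refine mul_le_of_le_one_left (norm_nonneg _) ?_
    rw [fourier_eq_ec]
    rw [← (φ n).integral_normed (μ := volume)]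
    refine norm_integral_le_of_norm_le (hφi n) (Eventually.of_forall fun t => ?_)
    rw [norm_mul, norm_ec, mul_one, Complex.norm_real,
      Real.norm_of_nonneg ((φ n).nonneg_normed t)]
  · refine ContDiffBump.convolution_tendsto_right_of_continuous ?_ hf x
    exact tendsto_one_div_add_atTop_nhds_zero_nat

lemma main_aux (μ : Measure (VV d)) [μ.Regular]
    (hTB : ∀ K : Set (VV d), IsCompact K → (⨆ x : VV d, μ (x +ᵥ K)) < ⊤)
    (hSAP : ∀ f : VV d → ℂ, Continuous f → HasCompactSupport f →
      IsBohrAlmostPeriodic fun t => ∫ x, f (t - x) ∂μ)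
    (c : VV d → ℂ) (hc : ∀ χ, IsFourierBohrCoeff μ χ (c χ))
    (hsum : ∀ K : Set (VV d), IsCompact K → Summable fun x : K => ‖c x‖)
    (f : VV d → ℂ) (hf : Continuous f) (hfc : HasCompactSupport f) :
    Integrable (fun ξ => ‖𝓕⁻ f ξ‖ ^ 2) μ ∧ (Summable fun x => c x * acr f x) ∧
      ∑' x, c x * acr f x = ((∫ ξ, ‖𝓕⁻ f ξ‖ ^ 2 ∂μ : ℝ) : ℂ) := by
  obtain ⟨M, hM⟩ := hfc.exists_bound_of_continuous hf
  obtain ⟨r, hr'⟩ := hfc.isCompact.isBounded.subset_ball (0 : VV d)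
  have hr : ∀ y, r ≤ ‖y‖ → f y = 0 := by
    intro y hy
    by_contra hne
    have := hr' (subset_tsupport f hne)
    rw [mem_ball_zero_iff] at this
    linarith
  have hr1 : ∀ y, r + 1 ≤ ‖y‖ → f y = 0 := fun y hy => hr y (by linarith)
  obtain ⟨fn, hns, hnc, hnM, hnr, hnF, hnt⟩ := mollify hf hfc hM hr
  set B := ∫ s : VV d, (ball (0 : VV d) (r + 1)).indicator (fun _ => M * M) s with hB
  set ρ := 2 * (r + 1) with hρ
  set bd : VV d → ℝ := fun x => (closedBall (0 : VV d) ρ).indicator (fun x => ‖c x‖) x * B with hbd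
  have hbdS : Summable bd := sum_loc hsum ρ B
  have hnbd : ∀ n x, ‖c x * acr (fn n) x‖ ≤ bd x := fun n x =>
    le_loc (acr_bound (hnM n) (hnr n)) (fun x hx => acr_zero (hnr n) hx) x
  have hfbd : ∀ x, ‖c x * acr f x‖ ≤ bd x := fun x =>
    le_loc (acr_bound hM hr1) (fun x hx => acr_zero hr1 hx) x
  have hS : Summable fun x => c x * acr f x := Summable.of_norm_bounded hbdS hfbd
  have hsm : ∀ n, Integrable (fun ξ => ‖𝓕⁻ (fn n) ξ‖ ^ 2) μ ∧
      ∑' x, c x * acr (fn n) x = ((∫ ξ, ‖𝓕⁻ (fn n) ξ‖ ^ 2 ∂μ : ℝ) : ℂ) := by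
    intro n
    obtain ⟨A, hA⟩ := smooth_decay (hns n) (hnc n)
    have hi : Integrable (fn n) := (hns n).continuous.integrable_of_hasCompactSupport (hnc n)
    have hcont : Continuous (fun y => ((‖𝓕 (fn n) y‖ ^ 2 : ℝ) : ℂ)) := by
      have h1 := continuous_fourierInv hi
      have h2 : 𝓕 (fn n) = fun y => 𝓕⁻ (fn n) (-y) := by
        ext y; rw [fourierInv_eq_neg, neg_neg]
      rw [h2]; fun_prop
    have hp := poisson μ hTB hSAP c hc hcont hA ?_
    · simp only [plancherel_acr (hns n) (hnc n), ← fourierInv_eq_neg] at hp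
      refine ⟨?_, ?_⟩
      · have := hp.1.re
        exact this
      · rw [← hp.2, integral_complex_ofReal]
    · simp only [plancherel_acr (hns n) (hnc n)]
      exact Summable.of_nonneg_of_le (fun x => norm_nonneg _) (hnbd n) hbdS
  have hacr : ∀ x, Tendsto (fun n => acr (fn n) x) atTop (𝓝 (acr f x)) := by
    intro x
    refine tendsto_integral_of_dominated_convergence _ ?_ (integrable_ind (r + 1) (M * M)) ?_ ?_
    · intro n
      have := (hns n).continuous
      exact Continuous.aestronglyMeasurable (by fun_prop)
    · intro n
      exact Eventually.of_forall fun s => acr_int_bound (hnM n) (hnr n) x s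
    · refine Eventually.of_forall fun s => (hnt s).mul ?_
      exact (Complex.continuous_conj.tendsto _).comp (hnt (s + x))
  have hts : Tendsto (fun n => ∑' x, c x * acr (fn n) x) atTop (𝓝 (∑' x, c x * acr f x)) :=
    tendsto_tsum_of_dominated_convergence hbdS (fun x => (hacr x).const_mul _)
      (Eventually.of_forall hnbd)
  have hFt : ∀ ξ, Tendsto (fun n => 𝓕⁻ (fn n) ξ) atTop (𝓝 (𝓕⁻ f ξ)) := by
    intro ξ
    simp_rw [fourierInv_eq_ec]
    refine tendsto_integral_of_dominated_convergence _ ?_ (integrable_ind (r + 1) M) ?_ ?_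
    · intro n
      have := (hns n).continuous
      exact Continuous.aestronglyMeasurable (by fun_prop)
    · intro n
      refine Eventually.of_forall fun s => ?_
      rw [norm_mul, norm_ec, mul_one]
      by_cases hs : s ∈ ball (0 : VV d) (r + 1)
      · rw [Set.indicator_of_mem hs]; exact hnM n s
      · rw [Set.indicator_of_notMem hs, hnr n s (by simpa using hs)]; simp
    · exact Eventually.of_forall fun s => (hnt s).mul_const _
  have hFt2 : ∀ ξ, Tendsto (fun n => ‖𝓕⁻ (fn n) ξ‖ ^ 2) atTop (𝓝 (‖𝓕⁻ f ξ‖ ^ 2)) :=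
    fun ξ => (hFt ξ).norm.pow 2
  have hcf : Continuous (𝓕⁻ f) := continuous_fourierInv (hf.integrable_of_hasCompactSupport hfc)
  have hcfn : ∀ n, Continuous (𝓕⁻ (fn n)) := fun n => continuous_fourierInv
    ((hns n).continuous.integrable_of_hasCompactSupport (hnc n))
  have hre : Tendsto (fun n => ∫ ξ, ‖𝓕⁻ (fn n) ξ‖ ^ 2 ∂μ) atTop
      (𝓝 (∑' x, c x * acr f x).re) := by
    refine ((Complex.continuous_re.tendsto _).comp hts).congr fun n => ?_
    simp only [Function.comp, (hsm n).2, Complex.ofReal_re]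
  have hIntF : Integrable (fun ξ => ‖𝓕⁻ f ξ‖ ^ 2) μ := by
    refine ⟨Continuous.aestronglyMeasurable (by fun_prop), ?_⟩
    rw [hasFiniteIntegral_iff_ofReal (Eventually.of_forall fun ξ => by positivity)]
    have h1 : ∀ ξ, ENNReal.ofReal (‖𝓕⁻ f ξ‖ ^ 2) =
        liminf (fun n => ENNReal.ofReal (‖𝓕⁻ (fn n) ξ‖ ^ 2)) atTop := fun ξ =>
      ((ENNReal.tendsto_ofReal (hFt2 ξ)).liminf_eq).symm
    simp_rw [h1]
    refine (lintegral_liminf_le fun n => ?_).trans_lt ?_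
    · have := hcfn n
      exact (Continuous.measurable (by fun_prop)).ennreal_ofReal
    · have h2 : ∀ n, ∫⁻ ξ, ENNReal.ofReal (‖𝓕⁻ (fn n) ξ‖ ^ 2) ∂μ =
          ENNReal.ofReal (∫ ξ, ‖𝓕⁻ (fn n) ξ‖ ^ 2 ∂μ) := fun n =>
        (ofReal_integral_eq_lintegral_ofReal (hsm n).1
          (Eventually.of_forall fun ξ => by positivity)).symm
      simp_rw [h2]
      rw [(ENNReal.tendsto_ofReal hre).liminf_eq]
      exact ENNReal.ofReal_lt_top
  refine ⟨hIntF, hS, ?_⟩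
  have hlim : Tendsto (fun n => ∫ ξ, ‖𝓕⁻ (fn n) ξ‖ ^ 2 ∂μ) atTop (𝓝 (∫ ξ, ‖𝓕⁻ f ξ‖ ^ 2 ∂μ)) := by
    refine tendsto_integral_of_dominated_convergence _ (fun n => (hsm n).1.1) hIntF ?_
      (Eventually.of_forall hFt2)
    intro n
    refine Eventually.of_forall fun ξ => ?_
    rw [norm_pow, norm_norm]
    gcongr
    exact hnF n ξ
  refine tendsto_nhds_unique hts ?_
  refine ((Complex.continuous_ofReal.tendsto _).comp hlim).congr fun n => ?_
  simp only [Function.comp, (hsm n).2]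
end final

/-- Let `μ` be a positive, translation bounded, strongly almost periodic Radon
measure on `ℝ^d` with Fourier–Bohr coefficients `c`, and assume `c` is locally absolutely
summable. Then `μ` is the Fourier transform of the pure point measure `ν = ∑_x c(x) δ_{-x}`:
for every continuous compactly supported `f`, `‖𝓕⁻¹f‖²` is `μ`-integrable, the family
`(c(x)·(f*f̃)(-x))_x` is summable, and `∑_x c(x)·(f*f̃)(-x) = ∫ ‖𝓕⁻¹f‖² dμ`. -/
theorem fourierTransformable_sap_stmt7 {d : ℕ}
    (μ : Measure (EuclideanSpace ℝ (Fin d))) [μ.Regular]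
    (hTB : ∀ K : Set (EuclideanSpace ℝ (Fin d)), IsCompact K →
      (⨆ x : EuclideanSpace ℝ (Fin d), μ (x +ᵥ K)) < ⊤)
    (hSAP : ∀ f : EuclideanSpace ℝ (Fin d) → ℂ, Continuous f → HasCompactSupport f →
      IsBohrAlmostPeriodic fun t => ∫ x, f (t - x) ∂μ)
    (c : EuclideanSpace ℝ (Fin d) → ℂ)
    (hc : ∀ χ : EuclideanSpace ℝ (Fin d), IsFourierBohrCoeff μ χ (c χ))
    (hsum : ∀ K : Set (EuclideanSpace ℝ (Fin d)), IsCompact K →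
      Summable fun x : K => ‖c x‖) :
    ∀ f : EuclideanSpace ℝ (Fin d) → ℂ, Continuous f → HasCompactSupport f →
      Integrable (fun ξ => ‖𝓕⁻ f ξ‖ ^ 2) μ ∧
      (Summable fun x : EuclideanSpace ℝ (Fin d) =>
        c x * ∫ s, f s * (starRingEnd ℂ) (f (s + x))) ∧
      ∑' x : EuclideanSpace ℝ (Fin d), c x * ∫ s, f s * (starRingEnd ℂ) (f (s + x))
        = ((∫ ξ, ‖𝓕⁻ f ξ‖ ^ 2 ∂μ : ℝ) : ℂ) := by
  exact fun f hf hfc => main_aux μ hTB hSAP c hc hsum f hf hfc
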